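/- arXiv:2512.02995 — 6 statements merged into one kernel-verified Lean document; each statement's English description precedes it below -/
import Mathlib

section
/- There exists a constant C > 0 such that for every integer n ≥ 2, the number α(n) of antichains in the n-dimensional Boolean lattice satisfies log₂ α(n) ≤ (1 + C·(log₂ n)/√n) · C(n, ⌊n/2⌋), where C(n, ⌊n/2⌋) denotes the binomial coefficient 'n choose ⌊n/2⌋'. (Kleitman's theorem on Dedekind's problem.) -/
/-- The number of antichains in the `n`-dimensional Boolean lattice. -/
noncomputable def alphaBool (n : ℕ) : ℕ :=
  Nat.card {A : Finset (Finset (Fin n)) // IsAntichain (· ⊆ ·) (A : Set (Finset (Fin n)))}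

open Finset
open scoped Nat

/-! ### Binomial coefficients -/

lemma le_choose_of_pos_of_lt {m k : ℕ} (hk : 0 < k) (hkm : k < m) : m ≤ m.choose k := by
  induction m generalizing k with
  | zero => omega
  | succ m ih =>
    obtain ⟨k, rfl⟩ := Nat.exists_eq_add_one_of_ne_zero hk.ne'
    rw [Nat.choose_succ_succ']
    rcases Nat.eq_zero_or_pos k with rfl | hk0
    · simp [Nat.add_comm]
    · have h₁ := ih hk0 (by omega)
      have h₂ : 0 < m.choose (k + 1) := Nat.choose_pos (by omega)
      omega

lemma sixteen_pow_le_mul_centralBinom_sq {k : ℕ} (hk : 0 < k) :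
    16 ^ k ≤ 4 * k * k.centralBinom ^ 2 := by
  induction k, hk using Nat.le_induction with
  | base => simp [Nat.centralBinom, Nat.choose]
  | succ k hk ih =>
    have h := Nat.succ_mul_centralBinom_succ k
    refine le_of_mul_le_mul_left ?_ k.succ_pos
    calc (k + 1) * 16 ^ (k + 1) = 16 * (k + 1) * 16 ^ k := by ring
      _ ≤ 16 * (k + 1) * (4 * k * k.centralBinom ^ 2) := by gcongr
      _ = 16 * (4 * k * (k + 1)) * k.centralBinom ^ 2 := by ring
      _ ≤ 16 * (2 * k + 1) ^ 2 * k.centralBinom ^ 2 := by gcongr; nlinarith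
      _ = 4 * (2 * (2 * k + 1) * k.centralBinom) ^ 2 := by ring
      _ = 4 * ((k + 1) * (k + 1).centralBinom) ^ 2 := by rw [← h]
      _ = (k + 1) * (4 * (k + 1) * (k + 1).centralBinom ^ 2) := by ring

lemma four_pow_le_mul_choose_half_sq {n : ℕ} (hn : 0 < n) :
    4 ^ n ≤ 4 * n * n.choose (n / 2) ^ 2 := by
  obtain ⟨k, rfl | rfl⟩ := Nat.even_or_odd' n
  · have h := sixteen_pow_le_mul_centralBinom_sq (k := k) (by omega)
    rw [Nat.centralBinom] at h
    rw [Nat.mul_div_cancel_left _ two_pos, pow_mul]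
    norm_num
    nlinarith [sq_nonneg ((2 * k).choose k)]
  · have h := sixteen_pow_le_mul_centralBinom_sq (k := k + 1) (by omega)
    have hc : (k + 1).centralBinom = 2 * (2 * k + 1).choose k := by
      rw [Nat.centralBinom, Nat.mul_succ, Nat.choose_succ_succ,
        Nat.choose_symm_half]
      ring
    have hd : (2 * k + 1) / 2 = k := by omega
    have hp : (4 : ℕ) ^ (2 * k + 1) * 4 = 16 ^ (k + 1) := by
      rw [← pow_succ, show 2 * k + 1 + 1 = 2 * (k + 1) by ring, pow_mul]
      norm_num
    rw [hd]
    rw [hc] at h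
    nlinarith [sq_nonneg ((2 * k + 1).choose k)]

lemma two_pow_le_mul_choose_half {n : ℕ} (hn : 0 < n) :
    (2 : ℝ) ^ n ≤ 2 * √n * n.choose (n / 2) := by
  refine le_of_sq_le_sq ?_ (by positivity)
  have h : ((4 ^ n : ℕ) : ℝ) ≤ (4 * n * n.choose (n / 2) ^ 2 : ℕ) :=
    Nat.cast_le.2 (four_pow_le_mul_choose_half_sq hn)
  push_cast at h
  calc ((2 : ℝ) ^ n) ^ 2 = 4 ^ n := by rw [← pow_mul, mul_comm, pow_mul]; norm_num
    _ ≤ 4 * n * n.choose (n / 2) ^ 2 := h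
    _ = (2 * √n * n.choose (n / 2)) ^ 2 := by
      rw [mul_pow, mul_pow, Real.sq_sqrt n.cast_nonneg]; ring

/-! ### Counting maximal chains through comparable sets -/

namespace Numbering

variable {X : Type*} [Fintype X] [DecidableEq X] {s t : Finset X}

lemma card_prefixed_inter_prefixed_le (hst : s ⊆ t) :
    #(prefixed s ∩ prefixed t) ≤ (#s)! * (#t - #s)! * (Fintype.card X - #t)! := by
  have hs : #(s.subtype (· ∈ t)) = #s := by
    rw [card_subtype, filter_true_of_mem fun x hx ↦ hst hx]
  have hcard : #(prefixed (s.subtype (· ∈ t)) ×ˢ (univ : Finset (Numbering ↑(tᶜ)))) =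
      (#s)! * (#t - #s)! * (Fintype.card X - #t)! := by
    rw [card_product, card_prefixed, hs, card_univ, Fintype.card_numbering]
    simp
  rw [← hcard, ← card_attach]
  refine card_le_card_of_injOn
    (fun f ↦ prefixedEquiv t ⟨f.1, (mem_inter.1 f.2).2⟩) ?_ ?_
  · rintro ⟨f, hf⟩ -
    simp only [coe_product, coe_univ, Set.mem_prod, Set.mem_univ, and_true, mem_coe, mem_prefixed]
    intro x
    rw [hs, mem_subtype]
    exact mem_prefixed.1 (mem_inter.1 hf).1 x
  · rintro ⟨f, hf⟩ - ⟨g, hg⟩ - h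
    simpa using h

lemma card_mul_card_prefixed_inter_le (hs : s.Nonempty) (hst : s ⊂ t) :
    #t * #(prefixed s ∩ prefixed t) ≤ #(prefixed t) := by
  have hlt := card_lt_card hst
  calc #t * #(prefixed s ∩ prefixed t)
      ≤ (#t).choose #s * ((#s)! * (#t - #s)! * (Fintype.card X - #t)!) :=
        Nat.mul_le_mul (le_choose_of_pos_of_lt hs.card_pos hlt)
          (card_prefixed_inter_prefixed_le hst.1)
    _ = #(prefixed t) := by
      rw [card_prefixed, ← Nat.choose_mul_factorial_mul_factorial hlt.le]; ring

lemma card_compl_mul_card_prefixed_inter_le (ht : t ≠ univ) (hst : s ⊂ t) :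
    (Fintype.card X - #s) * #(prefixed s ∩ prefixed t) ≤ #(prefixed s) := by
  have hlt := card_lt_card hst
  have htlt : #t < Fintype.card X := (card_lt_iff_ne_univ t).2 ht
  have hsub : Fintype.card X - #s - (#t - #s) = Fintype.card X - #t := by omega
  calc (Fintype.card X - #s) * #(prefixed s ∩ prefixed t)
      ≤ (Fintype.card X - #s).choose (#t - #s) *
          ((#s)! * (#t - #s)! * (Fintype.card X - #t)!) :=
        Nat.mul_le_mul (le_choose_of_pos_of_lt (by omega) (by omega))
          (card_prefixed_inter_prefixed_le hst.1)
    _ = #(prefixed s) := by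
      rw [card_prefixed, ← Nat.choose_mul_factorial_mul_factorial
        (show #t - #s ≤ Fintype.card X - #s by omega), hsub]
      ring

lemma factorial_le_card_prefixed_mul_choose_half (s : Finset X) :
    (Fintype.card X)! ≤ #(prefixed s) * (Fintype.card X).choose (Fintype.card X / 2) := by
  rw [card_prefixed, ← Nat.choose_mul_factorial_mul_factorial s.card_le_univ, mul_assoc, mul_comm]
  exact Nat.mul_le_mul_left _ (Nat.choose_le_middle _ _)

/-- Every numbering with `k ≥ 1` prefixes in `T` has at least `k - 1` pairs of nested prefixes. -/
lemma sum_card_prefixed_le (T : Finset (Finset X)) :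
    ∑ s ∈ T, #(prefixed s) ≤ (Fintype.card X)! +
      ∑ s ∈ T, ∑ t ∈ T with s ⊂ t, #(prefixed s ∩ prefixed t) := by
  have hf (f : Numbering X) : #{s ∈ T | IsPrefix f s} ≤
      1 + ∑ s ∈ T, #{t ∈ T | s ⊂ t ∧ IsPrefix f s ∧ IsPrefix f t} := by
    rcases (T.filter (IsPrefix f)).eq_empty_or_nonempty with h | h
    · simp [h]
    obtain ⟨s, hs, hmin⟩ := exists_min_image _ card h
    have hsub : {s ∈ T | IsPrefix f s} ⊆
        insert s {t ∈ T | s ⊂ t ∧ IsPrefix f s ∧ IsPrefix f t} := by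
      intro t ht
      rcases eq_or_ne t s with rfl | hne
      · exact mem_insert_self _ _
      have hst := hmin t ht
      rw [mem_filter] at hs ht
      refine mem_insert_of_mem (mem_filter.2 ⟨ht.1, ?_, hs.2, ht.2⟩)
      exact (hs.2.subset_of_card_le_card ht.2 hst).ssubset_of_ne hne.symm
    have hle := single_le_sum (f := fun s ↦ #{t ∈ T | s ⊂ t ∧ IsPrefix f s ∧ IsPrefix f t})
      (fun _ _ ↦ Nat.zero_le _) (mem_filter.1 hs).1
    have := (card_le_card hsub).trans (card_insert_le _ _)
    omega
  calc ∑ s ∈ T, #(prefixed s) = ∑ f : Numbering X, #{s ∈ T | IsPrefix f s} := by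
        simp only [prefixed, card_filter]
        exact sum_comm
    _ ≤ ∑ f : Numbering X,
          (1 + ∑ s ∈ T, #{t ∈ T | s ⊂ t ∧ IsPrefix f s ∧ IsPrefix f t}) :=
        sum_le_sum fun f _ ↦ hf f
    _ = _ := by
      rw [sum_add_distrib, sum_const, card_univ, Fintype.card_numbering, smul_eq_mul, mul_one,
        sum_comm]
      congr 1
      refine sum_congr rfl fun s _ ↦ ?_
      simp only [prefixed, ← filter_and, card_filter, sum_filter]
      rw [sum_comm]
      refine sum_congr rfl fun t _ ↦ ?_
      by_cases hst : s ⊂ t <;> simp [hst]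

end Numbering

/-! ### Sparse families are small -/

section Neighbours

variable {α : Type*} [DecidableEq α] (r : α → α → Prop) [DecidableRel r]

/-- The elements of `T` other than `v` that are related to `v`. -/
def neighboursIn (T : Finset α) (v : α) : Finset α :=
  {w ∈ T | w ≠ v ∧ (r v w ∨ r w v)}

/-- The number of antichains for `r` contained in `T`. -/
noncomputable def numAntichains (T : Finset α) : ℕ :=
  open scoped Classical in #(T.powerset.filter fun A : Finset α ↦ IsAntichain r (A : Set α))

end Neighbours

open Numbering in
/-- If every member of a family of proper nonempty sets is comparable to at most `D` others,
then the family is not much larger than the middle layer. -/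
lemma card_le_of_card_neighboursIn_le {n D : ℕ} {T : Finset (Finset (Fin n))}
    (hempty : ∅ ∉ T) (huniv : univ ∉ T)
    (hT : ∀ s ∈ T, #(neighboursIn (· ⊆ ·) T s) ≤ D) :
    (n - 2 * D) * #T ≤ n * n.choose (n / 2) := by
  have hpair : ∀ s ∈ T, ∀ t ∈ T, s ⊂ t → n * #(prefixed s ∩ prefixed t) ≤
      (if 2 * #t < n then 2 * #(prefixed s) else 0) +
        (if n ≤ 2 * #t then 2 * #(prefixed t) else 0) := by
    intro s hs t ht hst
    have hlt := card_lt_card hst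
    by_cases h : 2 * #t < n
    · have := card_compl_mul_card_prefixed_inter_le (ne_of_mem_of_not_mem ht huniv) hst
      simp only [Fintype.card_fin] at this
      rw [if_pos h, if_neg h.not_ge, add_zero]
      calc n * #(prefixed s ∩ prefixed t)
          ≤ 2 * (n - #s) * #(prefixed s ∩ prefixed t) := Nat.mul_le_mul_right _ (by omega)
        _ ≤ 2 * #(prefixed s) := by rw [mul_assoc]; exact Nat.mul_le_mul_left _ this
    · have := card_mul_card_prefixed_inter_le
        (nonempty_iff_ne_empty.2 (ne_of_mem_of_not_mem hs hempty)) hst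
      rw [if_neg h, if_pos (not_lt.1 h), zero_add]
      calc n * #(prefixed s ∩ prefixed t)
          ≤ 2 * #t * #(prefixed s ∩ prefixed t) := Nat.mul_le_mul_right _ (by omega)
        _ ≤ 2 * #(prefixed t) := by rw [mul_assoc]; exact Nat.mul_le_mul_left _ this
  have hcharge : n * ∑ s ∈ T, ∑ t ∈ T with s ⊂ t, #(prefixed s ∩ prefixed t) ≤
      2 * D * ∑ s ∈ T, #(prefixed s) := by
    calc n * ∑ s ∈ T, ∑ t ∈ T with s ⊂ t, #(prefixed s ∩ prefixed t)
        ≤ ∑ s ∈ T, ∑ t ∈ T with s ⊂ t, ((if 2 * #t < n then 2 * #(prefixed s) else 0) +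
            (if n ≤ 2 * #t then 2 * #(prefixed t) else 0)) := by
          simp only [mul_sum]
          refine sum_le_sum fun s hs ↦ sum_le_sum fun t ht ↦ ?_
          rw [mem_filter] at ht
          exact hpair s hs t ht.1 ht.2
      _ = ∑ s ∈ T, (#{t ∈ T | s ⊂ t ∧ 2 * #t < n} + #{t ∈ T | t ⊂ s ∧ n ≤ 2 * #s}) *
            (2 * #(prefixed s)) := by
          simp only [sum_add_distrib, add_mul]
          congr 1
          · refine sum_congr rfl fun s _ ↦ ?_
            rw [← sum_filter, filter_filter, sum_const, smul_eq_mul]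
          · simp only [sum_filter]
            rw [sum_comm]
            refine sum_congr rfl fun t _ ↦ ?_
            simp only [← ite_and]
            rw [← sum_filter, sum_const, smul_eq_mul]
      _ ≤ ∑ s ∈ T, D * (2 * #(prefixed s)) := by
          refine sum_le_sum fun s hs ↦ Nat.mul_le_mul_right _ (le_trans ?_ (hT s hs))
          rw [← card_union_of_disjoint]
          · refine card_le_card fun t ht ↦ ?_
            simp only [mem_union, mem_filter, neighboursIn] at ht ⊢
            rcases ht with ⟨h, h', -⟩ | ⟨h, h', -⟩
            · exact ⟨h, h'.ne', Or.inl h'.1⟩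
            · exact ⟨h, h'.ne, Or.inr h'.1⟩
          · refine disjoint_filter.2 fun t _ h h' ↦ ?_
            exact h.1.2 h'.1.1
      _ = _ := by rw [mul_sum]; exact sum_congr rfl fun s _ ↦ by ring
  have hsum := sum_card_prefixed_le T
  simp only [Fintype.card_fin] at hsum
  have hupper : (n - 2 * D) * ∑ s ∈ T, #(prefixed s) ≤ n * n ! := by
    rw [Nat.sub_mul]
    have := Nat.mul_le_mul_left n hsum
    rw [mul_add] at this
    omega
  have hlower : #T * n ! ≤ (∑ s ∈ T, #(prefixed s)) * n.choose (n / 2) := by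
    rw [sum_mul, ← smul_eq_mul, ← sum_const]
    refine sum_le_sum fun s _ ↦ ?_
    simpa using factorial_le_card_prefixed_mul_choose_half s
  refine le_of_mul_le_mul_right ?_ n.factorial_pos
  calc (n - 2 * D) * #T * n ! = (n - 2 * D) * (#T * n !) := mul_assoc _ _ _
    _ ≤ (n - 2 * D) * ((∑ s ∈ T, #(prefixed s)) * n.choose (n / 2)) :=
        Nat.mul_le_mul_left _ hlower
    _ = (n - 2 * D) * (∑ s ∈ T, #(prefixed s)) * n.choose (n / 2) := (mul_assoc _ _ _).symm
    _ ≤ n * n ! * n.choose (n / 2) := Nat.mul_le_mul_right _ hupper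
    _ = n * n.choose (n / 2) * n ! := by ring

lemma exists_le_card_neighboursIn {n D : ℕ} {T : Finset (Finset (Fin n))}
    (hT : n * n.choose (n / 2) < (n - 2 * D) * (#T - 2)) :
    ∃ s ∈ T, D ≤ #(neighboursIn (· ⊆ ·) T s) := by
  by_contra! h
  refine hT.not_ge ?_
  have hcard : #T - 2 ≤ #((T.erase ∅).erase univ) := by
    have h₁ := pred_card_le_card_erase (s := T) (a := ∅)
    have h₂ := pred_card_le_card_erase (s := T.erase ∅) (a := univ)
    omega
  refine (Nat.mul_le_mul_left _ hcard).trans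
    (card_le_of_card_neighboursIn_le (by simp) (by simp) fun s hs ↦ ?_)
  have hsub : (T.erase ∅).erase univ ⊆ T := (erase_subset _ _).trans (erase_subset _ _)
  exact (card_le_card (filter_subset_filter _ hsub)).trans (h s (hsub hs)).le

/-! ### Counting antichains by deleting vertices of large degree -/

lemma numAntichains_le_two_pow {α : Type*} {r : α → α → Prop} (T : Finset α) : numAntichains r T ≤ 2 ^ #T := by
  classical
  exact (card_filter_le _ _).trans (card_powerset T).le

section Counting

variable {α : Type*} [DecidableEq α] {r : α → α → Prop} [DecidableRel r]

lemma numAntichains_le_add {T : Finset α} {v : α} :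
    numAntichains r T ≤ numAntichains r (T.erase v) +
      numAntichains r (T.erase v \ neighboursIn r T v) := by
  classical
  unfold numAntichains
  rw [← card_filter_add_card_filter_not (s := T.powerset.filter fun A : Finset α ↦ IsAntichain r (A : Set α))
    (p := fun A ↦ v ∉ A)]
  refine Nat.add_le_add (card_le_card fun A hA ↦ ?_) ?_
  · simp only [mem_filter, mem_powerset] at hA ⊢
    exact ⟨subset_erase.2 ⟨hA.1.1, hA.2⟩, hA.1.2⟩
  · refine card_le_card_of_injOn (fun A ↦ A.erase v) (fun A hA ↦ ?_) fun A hA B hB hAB ↦ ?_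
    · simp only [coe_filter, Set.mem_ofPred_eq, mem_filter, mem_powerset, not_not] at hA ⊢
      obtain ⟨⟨hAT, hA⟩, hv⟩ := hA
      refine ⟨fun w hw ↦ ?_, hA.subset (by simp)⟩
      rw [mem_erase] at hw
      simp only [mem_sdiff, mem_erase, neighboursIn, mem_filter, not_and, not_or]
      exact ⟨⟨hw.1, hAT hw.2⟩, fun _ _ ↦ ⟨hA hv hw.2 hw.1.symm, hA hw.2 hv hw.1⟩⟩
    · simp only [coe_filter, Set.mem_ofPred_eq, not_not] at hA hB
      rw [← insert_erase hA.2, ← insert_erase hB.2]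
      exact congrArg _ hAB

/-- If every set of more than `m` elements contains a vertex of degree at least `d`, then
the number of antichains grows slowly beyond size `m`. -/
lemma numAntichains_le_mul_pow {d : ℕ} {m B c : ℝ} (hB : 0 ≤ B) (hc : 1 ≤ c)
    (hcd : c ^ d + 1 ≤ c ^ (d + 1))
    (hsmall : ∀ T : Finset α, (#T : ℝ) ≤ m → (numAntichains r T : ℝ) ≤ B)
    (hlarge : ∀ T : Finset α, m < #T → ∃ v ∈ T, d ≤ #(neighboursIn r T v)) (T : Finset α) :
    (numAntichains r T : ℝ) ≤ B * c ^ #T := by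
  induction T using Finset.strongInduction with
  | H T ih =>
    rcases le_or_gt (#T : ℝ) m with h | h
    · exact (hsmall T h).trans (le_mul_of_one_le_right hB (one_le_pow₀ hc))
    obtain ⟨v, hv, hd⟩ := hlarge T h
    have hsub : neighboursIn r T v ⊆ T.erase v := fun w hw ↦ by
      simp only [neighboursIn, mem_filter] at hw
      exact mem_erase.2 ⟨hw.2.1, hw.1⟩
    have hcard := card_erase_add_one hv
    have hdle := hd.trans (card_le_card hsub)
    obtain ⟨k, hk⟩ := Nat.exists_eq_add_of_le hdle
    have hrest : #(T.erase v \ neighboursIn r T v) ≤ k := by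
      rw [card_sdiff_of_subset hsub]
      omega
    have h₁ := ih _ (erase_ssubset hv)
    have h₂ := ih _ (sdiff_subset.trans_ssubset (erase_ssubset hv) :
      T.erase v \ neighboursIn r T v ⊂ T)
    calc (numAntichains r T : ℝ)
        ≤ numAntichains r (T.erase v) + numAntichains r (T.erase v \ neighboursIn r T v) := by
          exact_mod_cast numAntichains_le_add
      _ ≤ B * c ^ (d + k) + B * c ^ k := by
          refine add_le_add (hk ▸ h₁) (h₂.trans ?_)
          gcongr
      _ = B * c ^ k * (c ^ d + 1) := by ring
      _ ≤ B * c ^ k * c ^ (d + 1) := by gcongr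
      _ = B * c ^ #T := by rw [← hcard, hk]; ring

end Counting

/-- The growth rate used when vertices of degree at least `d` are deleted. -/
noncomputable def growthRate (d : ℕ) : ℝ := 2 ^ (2 * Real.logb 2 d / d)

lemma one_le_growthRate {d : ℕ} (hd : 2 ≤ d) : 1 ≤ growthRate d := by
  have : 0 ≤ Real.logb 2 d := Real.logb_nonneg one_lt_two (by exact_mod_cast (by omega : 1 ≤ d))
  exact Real.one_le_rpow one_le_two (by positivity)

lemma growthRate_pow_add_one_le {d : ℕ} (hd : 2 ≤ d) :
    growthRate d ^ d + 1 ≤ growthRate d ^ (d + 1) := by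
  have hd' : (2 : ℝ) ≤ d := by exact_mod_cast hd
  have hd0 : (0 : ℝ) < d := by linarith
  have hpow : growthRate d ^ d = (d : ℝ) ^ 2 := by
    rw [growthRate, ← Real.rpow_natCast, ← Real.rpow_mul zero_le_two,
      div_mul_cancel₀ _ hd0.ne', mul_comm, Real.rpow_mul zero_le_two,
      Real.rpow_logb two_pos (by norm_num) hd0]
    norm_cast
  have hlog : Real.log 2 ≤ Real.log d := Real.log_le_log two_pos hd'
  have hrate : 1 + 2 * Real.log d / d ≤ growthRate d := by
    have := Real.add_one_le_exp (2 * Real.log d / d)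
    have heq : growthRate d = Real.exp (2 * Real.log d / d) := by
      rw [growthRate, Real.rpow_def_of_pos two_pos, Real.logb]
      congr 1
      field_simp
    linarith
  have hgain : 1 ≤ (d : ℝ) ^ 2 * (2 * Real.log d / d) := by
    have : (d : ℝ) ^ 2 * (2 * Real.log d / d) = 2 * d * Real.log d := by field_simp
    rw [this]
    nlinarith [Real.log_two_gt_d9]
  rw [pow_succ, hpow]
  nlinarith [sq_nonneg (d : ℝ)]

lemma logb_growthRate_pow (d k : ℕ) :
    Real.logb 2 (growthRate d ^ k) = k * (2 * Real.logb 2 d / d) := by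
  rw [Real.logb_pow, growthRate, Real.logb_rpow two_pos (by norm_num)]

/-! ### The number of antichains in the Boolean lattice -/

lemma alphaBool_eq_numAntichains (n : ℕ) :
    alphaBool n = numAntichains (· ⊆ ·) (univ : Finset (Finset (Fin n))) := by
  classical
  rw [alphaBool, numAntichains, Nat.card_eq_fintype_card, Fintype.card_subtype, powerset_univ]

lemma alphaBool_pos (n : ℕ) : 0 < alphaBool n := by
  have : Nonempty {A : Finset (Finset (Fin n)) //
      IsAntichain (· ⊆ ·) (A : Set (Finset (Fin n)))} := ⟨∅, by simp⟩
  exact Nat.card_pos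

lemma logb_alphaBool_le_two_pow (n : ℕ) : Real.logb 2 (alphaBool n) ≤ 2 ^ n := by
  rw [Real.logb_le_iff_le_rpow one_lt_two (by exact_mod_cast alphaBool_pos n)]
  have h := numAntichains_le_two_pow (r := (· ⊆ ·)) (univ : Finset (Finset (Fin n)))
  rw [← alphaBool_eq_numAntichains, card_univ, Fintype.card_finset, Fintype.card_fin] at h
  calc (alphaBool n : ℝ) ≤ ((2 ^ 2 ^ n : ℕ) : ℝ) := by exact_mod_cast h
    _ = (2 : ℝ) ^ ((2 : ℝ) ^ n) := by
      rw [← Nat.cast_ofNat (R := ℝ) (n := 2), ← Nat.cast_pow, Real.rpow_natCast]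
      norm_cast

/-- The bound obtained by deleting vertices of degree at least `n / 4` until about twice the
middle layer remains, and then vertices of degree at least `√n`. -/
lemma alphaBool_le {n : ℕ} (hn : 16 ≤ n) :
    (alphaBool n : ℝ) ≤ 2 ^ ((1 + 4 / √n) * n.choose (n / 2) + 2) *
      growthRate n.sqrt ^ (2 * n.choose (n / 2) + 2) * growthRate (n / 4) ^ (2 ^ n) := by
  set N := n.choose (n / 2)
  have hsqrt : 4 ≤ n.sqrt := Nat.le_sqrt.2 (by omega)
  have hn' : (16 : ℝ) ≤ n := by exact_mod_cast hn
  have hs : (4 : ℝ) ≤ √n := Real.le_sqrt_of_sq_le (by linarith)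
  have hss : √(n : ℝ) * √n = n := Real.mul_self_sqrt n.cast_nonneg
  have hsle : (n.sqrt : ℝ) ≤ √n := Real.nat_sqrt_le_real_sqrt
  have hsn : 4 * n.sqrt ≤ n := (Nat.mul_le_mul_right _ hsqrt).trans (Nat.sqrt_le n)
  have hc₁ := one_le_growthRate (d := n / 4) (by omega)
  have hc₂ := one_le_growthRate (d := n.sqrt) (by omega)
  have hB : (0 : ℝ) ≤ 2 ^ ((1 + 4 / √n) * N + 2) := by positivity
  have hfine (T : Finset (Finset (Fin n))) : (numAntichains (· ⊆ ·) T : ℝ) ≤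
      2 ^ ((1 + 4 / √n) * N + 2) * growthRate n.sqrt ^ #T := by
    refine numAntichains_le_mul_pow (m := (1 + 4 / √n) * N + 2) hB hc₂
      (growthRate_pow_add_one_le (by omega)) (fun T hT ↦ ?_) (fun T hT ↦ ?_) T
    · calc (numAntichains (· ⊆ ·) T : ℝ) ≤ 2 ^ #T := by exact_mod_cast numAntichains_le_two_pow T
        _ = (2 : ℝ) ^ (#T : ℝ) := (Real.rpow_natCast _ _).symm
        _ ≤ _ := Real.rpow_le_rpow_of_exponent_le one_le_two hT
    · have hT2 : 2 ≤ #T := by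
        have : (2 : ℝ) ≤ #T := le_trans (by simp; positivity) hT.le
        exact_mod_cast this
      refine exists_le_card_neighboursIn ?_
      rw [← Nat.cast_lt (α := ℝ), Nat.cast_mul, Nat.cast_mul, Nat.cast_sub (by omega),
        Nat.cast_sub hT2]
      push_cast
      have hN0 : (0 : ℝ) ≤ N := N.cast_nonneg
      have hkey : (n : ℝ) ≤ (n - 2 * √n) * (1 + 4 / √n) := by
        have : ((n : ℝ) - 2 * √n) * (1 + 4 / √n) = n + 2 * √n - 8 := by
          field_simp
          nlinarith
        linarith
      calc (n : ℝ) * N ≤ (n - 2 * √n) * (1 + 4 / √n) * N := by gcongr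
        _ = (n - 2 * √n) * ((1 + 4 / √n) * N) := mul_assoc _ _ _
        _ < (n - 2 * √n) * (#T - 2) := by
          have : 0 < (n : ℝ) - 2 * √n := by nlinarith
          gcongr
          linarith
        _ ≤ (n - 2 * n.sqrt) * (#T - 2) := by
          have : (2 : ℝ) ≤ #T := by exact_mod_cast hT2
          have : (0 : ℝ) ≤ #T - 2 := by linarith
          gcongr
  have hcoarse := numAntichains_le_mul_pow (r := ((· ⊆ ·) : Finset (Fin n) → _ → Prop))
    (d := n / 4) (m := 2 * N + 2) (c := growthRate (n / 4))
    (B := 2 ^ ((1 + 4 / √n) * N + 2) * growthRate n.sqrt ^ (2 * N + 2))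
    (by positivity) hc₁ (growthRate_pow_add_one_le (by omega)) (fun T hT ↦ ?_) (fun T hT ↦ ?_) univ
  · rw [alphaBool_eq_numAntichains]
    simpa using hcoarse
  · refine (hfine T).trans ?_
    gcongr
    exact_mod_cast hT
  · have hT' : 2 * N + 2 < #T := by exact_mod_cast hT
    refine exists_le_card_neighboursIn ?_
    calc n * N ≤ (n - 2 * (n / 4)) * (2 * N) := by
          rw [← mul_assoc]
          exact Nat.mul_le_mul_right _ (by omega)
      _ < (n - 2 * (n / 4)) * (#T - 2) := Nat.mul_lt_mul_of_pos_left (by omega) (by omega)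

lemma logb_alphaBool_le_of_sixteen_le {n : ℕ} (hn : 16 ≤ n) :
    Real.logb 2 (alphaBool n) ≤ (1 + 54 * Real.logb 2 n / √n) * n.choose (n / 2) := by
  have hbound := alphaBool_le hn
  have hpow := two_pow_le_mul_choose_half (n := n) (by omega)
  have hchoose : (n : ℝ) ≤ n.choose (n / 2) := by
    exact_mod_cast le_choose_of_pos_of_lt (by omega) (by omega)
  set N := n.choose (n / 2)
  have hn' : (16 : ℝ) ≤ n := by exact_mod_cast hn
  have hs : (4 : ℝ) ≤ √n := Real.le_sqrt_of_sq_le (by linarith)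
  have hss : √(n : ℝ) * √n = n := Real.mul_self_sqrt n.cast_nonneg
  have hL : 1 ≤ Real.logb 2 n := by
    rw [Real.le_logb_iff_rpow_le one_lt_two (by linarith)]
    norm_num
    linarith
  have hrate {d : ℕ} {x : ℝ} (hd : 0 < d) (hdn : d ≤ n) (hx : 0 < x) (hxd : x ≤ d) :
      2 * Real.logb 2 d / d ≤ 2 * Real.logb 2 n / x := by
    have : Real.logb 2 d ≤ Real.logb 2 n :=
      Real.logb_le_logb_of_le one_lt_two (by exact_mod_cast hd) (by exact_mod_cast hdn)
    gcongr
  have hnonneg {d : ℕ} (hd : 0 < d) : 0 ≤ 2 * Real.logb 2 d / d := by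
    have : 0 ≤ Real.logb 2 d := Real.logb_nonneg one_lt_two (by exact_mod_cast hd)
    positivity
  have hrate₁ := hrate (d := n / 4) (x := n / 8) (by omega) (by omega) (by positivity) (by
    have : n ≤ 8 * (n / 4) := by omega
    have : (n : ℝ) ≤ 8 * (n / 4 : ℕ) := by exact_mod_cast this
    linarith)
  have hrate₂ := hrate (d := n.sqrt) (x := √n / 2) (Nat.sqrt_pos.2 (by omega)) (Nat.sqrt_le_self n)
    (by positivity) (by
      have := Real.real_sqrt_le_nat_sqrt_succ (a := n)
      linarith)
  have hg₁ : 0 < growthRate (n / 4) := Real.rpow_pos_of_pos two_pos _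
  have hg₂ : 0 < growthRate n.sqrt := Real.rpow_pos_of_pos two_pos _
  have hlog := Real.logb_le_logb_of_le one_lt_two (by exact_mod_cast alphaBool_pos n) hbound
  rw [Real.logb_mul (by positivity) (by positivity), Real.logb_mul (by positivity) (by positivity),
    Real.logb_rpow two_pos (by norm_num), logb_growthRate_pow, logb_growthRate_pow] at hlog
  push_cast at hlog
  set L := Real.logb 2 n
  set u := N * L / √n with hu
  have hNs : 1 ≤ N / √n := by
    rw [le_div_iff₀ (by positivity)]
    nlinarith
  have hu_ge : N / √n ≤ u := by
    rw [hu]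
    gcongr
    nlinarith
  have hfine : (2 * N + 2) * (2 * Real.logb 2 n.sqrt / n.sqrt) ≤ 16 * u := by
    calc (2 * N + 2) * (2 * Real.logb 2 n.sqrt / n.sqrt)
        ≤ (2 * N + 2 * N) * (2 * L / (√n / 2)) := by
          refine mul_le_mul (by linarith) hrate₂ ?_ (by positivity)
          exact hnonneg (Nat.sqrt_pos.2 (by omega))
      _ = 16 * u := by rw [hu]; field_simp; ring
  have hcoarse : 2 ^ n * (2 * Real.logb 2 (n / 4 : ℕ) / (n / 4 : ℕ)) ≤ 32 * u := by
    calc 2 ^ n * (2 * Real.logb 2 (n / 4 : ℕ) / (n / 4 : ℕ))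
        ≤ 2 * √n * N * (2 * L / (n / 8)) :=
          mul_le_mul hpow hrate₁ (hnonneg (by omega)) (by positivity)
      _ = 2 * √n * N * (2 * L / (√n * √n / 8)) := by rw [hss]
      _ = 32 * u := by rw [hu]; field_simp; ring
  have hmain : (1 + 4 / √n) * N + 2 = N + 4 * (N / √n) + 2 := by ring
  have hgoal : (1 + 54 * L / √n) * N = N + 54 * u := by rw [hu]; ring
  rw [hgoal]
  linarith

/-- Kleitman's theorem on Dedekind's problem. -/
theorem stmt0 :
    ∃ C : ℝ, 0 < C ∧ ∀ n : ℕ, 2 ≤ n →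
      Real.logb 2 (alphaBool n) ≤
        (1 + C * Real.logb 2 n / Real.sqrt n) * (n.choose (n / 2)) := by
  refine ⟨2 ^ 18, by positivity, fun n hn ↦ ?_⟩
  have hn' : (2 : ℝ) ≤ n := by exact_mod_cast hn
  have hL : 1 ≤ Real.logb 2 n := by
    rw [Real.le_logb_iff_rpow_le one_lt_two (by linarith)]
    simpa using hn'
  rcases le_or_gt 16 n with h | h
  · refine (logb_alphaBool_le_of_sixteen_le h).trans ?_
    gcongr
    norm_num
  · have hN : (1 : ℝ) ≤ n.choose (n / 2) := by
      exact_mod_cast Nat.choose_pos (Nat.div_le_self n 2)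
    have hs : √(n : ℝ) ≤ 4 := by
      rw [Real.sqrt_le_left (by norm_num)]
      norm_num
      exact_mod_cast h.le
    have hs0 : 0 < √(n : ℝ) := Real.sqrt_pos.2 (by linarith)
    calc Real.logb 2 (alphaBool n) ≤ 2 ^ n := logb_alphaBool_le_two_pow n
      _ ≤ 2 ^ 16 := pow_le_pow_right₀ one_le_two h.le
      _ = 2 ^ 18 * 1 / 4 := by norm_num
      _ ≤ 2 ^ 18 * Real.logb 2 n / √n := by gcongr
      _ ≤ 1 + 2 ^ 18 * Real.logb 2 n / √n := by linarith
      _ ≤ (1 + 2 ^ 18 * Real.logb 2 n / √n) * n.choose (n / 2) :=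
        le_mul_of_one_le_right (by positivity) hN
end

section
/- There exists a constant C > 0 such that for every integer n ≥ 2, the number α(n) of antichains in the n-dimensional Boolean lattice satisfies log₂ α(n) ≤ (1 + C·(log₂ n)/n) · C(n, ⌊n/2⌋), where C(n, ⌊n/2⌋) denotes the binomial coefficient 'n choose ⌊n/2⌋'. (Kleitman–Markowsky bound for Dedekind's problem.) -/
open Finset

section FamilyEntropy

variable {V : Type*} [DecidableEq V]

/-- The members of `𝒜` with the same trace on `S` as `A`. -/
def traceClass (𝒜 : Finset (Finset V)) (S A : Finset V) : Finset (Finset V) :=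
  {B ∈ 𝒜 | B ∩ S = A ∩ S}

/-- The Shannon entropy (in nats) of the trace on `S` of a uniformly random member of `𝒜`,
multiplied by the number of members of `𝒜`. -/
noncomputable def traceEntropy (𝒜 : Finset (Finset V)) (S : Finset V) : ℝ :=
  ∑ A ∈ 𝒜, (Real.log #𝒜 - Real.log #(traceClass 𝒜 S A))

variable {𝒜 : Finset (Finset V)} {S T U A B : Finset V}

lemma mem_traceClass : B ∈ traceClass 𝒜 S A ↔ B ∈ 𝒜 ∧ B ∩ S = A ∩ S := by
  simp [traceClass]

lemma card_traceClass_pos (hA : A ∈ 𝒜) : (0 : ℝ) < #(traceClass 𝒜 S A) := by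
  exact_mod_cast card_pos.2 ⟨A, mem_traceClass.2 ⟨hA, rfl⟩⟩

lemma traceClass_congr (h : B ∩ S = A ∩ S) : traceClass 𝒜 S B = traceClass 𝒜 S A := by
  simp [traceClass, h]

lemma mem_iff_of_inter_eq (h : B ∩ S = A ∩ S) {x : V} (hx : x ∈ S) : x ∈ B ↔ x ∈ A := by
  have := congrArg (x ∈ ·) h
  simpa [hx] using this

lemma inter_eq_iff : B ∩ S = A ∩ S ↔ ∀ x ∈ S, (x ∈ B ↔ x ∈ A) := by
  refine ⟨fun h x hx => mem_iff_of_inter_eq h hx, fun h => ?_⟩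
  ext x
  simp only [mem_inter]
  constructor <;> rintro ⟨h1, h2⟩ <;> simp_all

lemma inter_union_eq_iff :
    B ∩ (S ∪ T) = A ∩ (S ∪ T) ↔ B ∩ S = A ∩ S ∧ B ∩ T = A ∩ T := by
  simp only [inter_eq_iff, mem_union, or_imp, forall_and]

lemma inter_eq_of_subset (hST : S ⊆ T) (h : B ∩ T = A ∩ T) : B ∩ S = A ∩ S :=
  inter_eq_iff.2 fun _ hx => mem_iff_of_inter_eq h (hST hx)

/-- Gibbs' inequality: a conditional entropy is at most the corresponding cross entropy. -/
lemma traceEntropy_sub_le_sum_neg_log (p : Finset V → ℝ) (hp : ∀ A ∈ 𝒜, 0 < p A)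
    (hsum : ∀ A ∈ 𝒜, ∑ B ∈ traceClass 𝒜 T A, p B / #(traceClass 𝒜 S B) ≤ 1) :
    traceEntropy 𝒜 S - traceEntropy 𝒜 T ≤ ∑ A ∈ 𝒜, -Real.log (p A) := by
  have hswap : ∑ A ∈ 𝒜, #(traceClass 𝒜 T A) * (p A / #(traceClass 𝒜 S A)) ≤ #𝒜 := by
    calc ∑ A ∈ 𝒜, #(traceClass 𝒜 T A) * (p A / #(traceClass 𝒜 S A))
        = ∑ A ∈ 𝒜, ∑ _B ∈ traceClass 𝒜 T A, p A / #(traceClass 𝒜 S A) := by simp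
      _ = ∑ B ∈ 𝒜, ∑ A ∈ traceClass 𝒜 T B, p A / #(traceClass 𝒜 S A) := by
          refine sum_comm' fun A B => ?_
          simp only [mem_traceClass]
          tauto
      _ ≤ ∑ B ∈ 𝒜, 1 := sum_le_sum hsum
      _ = #𝒜 := by simp
  have hpt : ∀ A ∈ 𝒜, Real.log #(traceClass 𝒜 T A) - Real.log #(traceClass 𝒜 S A) ≤
      -Real.log (p A) + (#(traceClass 𝒜 T A) * (p A / #(traceClass 𝒜 S A)) - 1) := by
    intro A hA
    have hT := card_traceClass_pos (S := T) hA
    have hS := card_traceClass_pos (S := S) hA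
    have hpA := hp A hA
    have := Real.log_le_sub_one_of_pos (mul_pos hT (div_pos hpA hS))
    rw [Real.log_mul hT.ne' (div_pos hpA hS).ne', Real.log_div hpA.ne' hS.ne'] at this
    linarith
  calc traceEntropy 𝒜 S - traceEntropy 𝒜 T
      = ∑ A ∈ 𝒜, (Real.log #(traceClass 𝒜 T A) - Real.log #(traceClass 𝒜 S A)) := by
        rw [traceEntropy, traceEntropy, ← sum_sub_distrib]
        exact sum_congr rfl fun _ _ => by ring
    _ ≤ _ := sum_le_sum hpt
    _ ≤ _ := by
        rw [sum_add_distrib, sum_sub_distrib]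
        simp only [sum_const, nsmul_eq_mul, mul_one]
        linarith

/-- Conditioning on more coordinates does not increase entropy. -/
lemma traceEntropy_union_sub_le (hTS : T ⊆ S) :
    traceEntropy 𝒜 (S ∪ U) - traceEntropy 𝒜 S ≤
      traceEntropy 𝒜 (T ∪ U) - traceEntropy 𝒜 T := by
  have key := traceEntropy_sub_le_sum_neg_log (𝒜 := 𝒜) (S := S ∪ U) (T := S)
    (fun A => #(traceClass 𝒜 (T ∪ U) A) / #(traceClass 𝒜 T A))
    (fun A hA => div_pos (card_traceClass_pos hA) (card_traceClass_pos hA)) ?_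
  · refine key.trans_eq ?_
    rw [traceEntropy, traceEntropy, ← sum_sub_distrib]
    refine sum_congr rfl fun A hA => ?_
    rw [Real.log_div (card_traceClass_pos hA).ne' (card_traceClass_pos hA).ne']
    ring
  · intro A hA
    have hTA := card_traceClass_pos (S := T) hA
    have hrw : ∀ B ∈ traceClass 𝒜 S A,
        (#(traceClass 𝒜 (T ∪ U) B) / #(traceClass 𝒜 T B) : ℝ) / #(traceClass 𝒜 (S ∪ U) B) =
        (∑ _C ∈ traceClass 𝒜 (T ∪ U) B, (1 : ℝ) / #(traceClass 𝒜 (S ∪ U) B)) /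
          #(traceClass 𝒜 T A) := by
      intro B hB
      rw [traceClass_congr (inter_eq_of_subset hTS (mem_traceClass.1 hB).2), sum_const,
        nsmul_eq_mul]
      ring
    rw [sum_congr rfl hrw, ← sum_div, div_le_one hTA]
    calc ∑ B ∈ traceClass 𝒜 S A, ∑ _C ∈ traceClass 𝒜 (T ∪ U) B,
          (1 : ℝ) / #(traceClass 𝒜 (S ∪ U) B)
        = ∑ C ∈ traceClass 𝒜 T A, ∑ B ∈ traceClass 𝒜 S A with B ∩ (T ∪ U) = C ∩ (T ∪ U),
          (1 : ℝ) / #(traceClass 𝒜 (S ∪ U) B) := by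
          refine sum_comm' fun B C => ?_
          simp only [mem_traceClass, mem_filter]
          constructor
          · rintro ⟨hB, hC, hCB⟩
            exact ⟨⟨hB, hCB.symm⟩, hC, (inter_union_eq_iff.1 hCB).1.trans
              (inter_eq_of_subset hTS hB.2)⟩
          · rintro ⟨⟨hB, hBC⟩, hC, -⟩
            exact ⟨hB, hC, hBC.symm⟩
      _ ≤ ∑ C ∈ traceClass 𝒜 T A, 1 := by
          refine sum_le_sum fun C _ => ?_
          rcases ({B ∈ traceClass 𝒜 S A | B ∩ (T ∪ U) = C ∩ (T ∪ U)}).eq_empty_or_nonempty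
            with h | ⟨B₀, hB₀⟩
          · simp [h]
          · simp only [mem_filter, mem_traceClass, inter_union_eq_iff] at hB₀
            have hsub : {B ∈ traceClass 𝒜 S A | B ∩ (T ∪ U) = C ∩ (T ∪ U)} ⊆
                traceClass 𝒜 (S ∪ U) B₀ := by
              intro B hB
              simp only [mem_filter, mem_traceClass, inter_union_eq_iff] at hB ⊢
              exact ⟨hB.1.1, hB.1.2.trans hB₀.1.2.symm, hB.2.2.trans hB₀.2.2.symm⟩
            rw [sum_congr rfl fun B hB => by
              rw [traceClass_congr (mem_traceClass.1 (hsub hB)).2], sum_const, nsmul_eq_mul,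
              mul_one_div, div_le_one (card_traceClass_pos hB₀.1.1)]
            exact_mod_cast card_le_card hsub
      _ = #(traceClass 𝒜 T A) := by simp

/-- Shearer's inequality, conditionally on the trace on `T`. -/
lemma mul_traceEntropy_union_sub_le {ι : Type*} (W : Finset ι) (N : ι → Finset V) (d : ℕ)
    (T L : Finset V) (hd : ∀ u ∈ L, #{v ∈ W | u ∈ N v} = d) :
    d * (traceEntropy 𝒜 (T ∪ L) - traceEntropy 𝒜 T) ≤
      ∑ v ∈ W, (traceEntropy 𝒜 (T ∪ (N v ∩ L)) - traceEntropy 𝒜 T) := by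
  induction L using Finset.induction_on with
  | empty => simp
  | insert u L hu ih =>
    have ih := ih fun w hw => hd w (mem_insert_of_mem hw)
    have hstep : ∀ v ∈ W, traceEntropy 𝒜 (T ∪ (N v ∩ L)) - traceEntropy 𝒜 T +
        (if u ∈ N v then traceEntropy 𝒜 (T ∪ insert u L) - traceEntropy 𝒜 (T ∪ L) else 0) ≤
        traceEntropy 𝒜 (T ∪ (N v ∩ insert u L)) - traceEntropy 𝒜 T := by
      intro v _
      split_ifs with huv
      · have h := traceEntropy_union_sub_le (𝒜 := 𝒜) (U := {u})
          (union_subset_union_right (s := T) (inter_subset_right (s₁ := N v) (s₂ := L)))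
        have e1 : T ∪ L ∪ {u} = T ∪ insert u L := by
          ext; simp
        have e2 : T ∪ N v ∩ L ∪ {u} = T ∪ (N v ∩ insert u L) := by
          ext x
          simp only [mem_union, mem_inter, mem_insert, mem_singleton]
          constructor
          · rintro ((h | h) | rfl) <;> tauto
          · tauto
        rw [e1, e2] at h
        linarith
      · rw [inter_insert_of_notMem huv, add_zero]
    have := sum_le_sum hstep
    rw [sum_add_distrib, ← sum_filter, sum_const, hd u (mem_insert_self u L), nsmul_eq_mul] at this
    linarith

/-- Summing a function of the trace on `S` over a class, weighted so that each trace counts once. -/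
lemma sum_traceClass_div (p g : Finset V → ℝ)
    (hpg : ∀ B ∈ traceClass 𝒜 T A, p B = g (B ∩ S)) :
    ∑ B ∈ traceClass 𝒜 T A, p B / #(traceClass 𝒜 (T ∪ S) B) =
      ∑ X ∈ (traceClass 𝒜 T A).image (· ∩ S), g X := by
  symm
  refine sum_image' _ fun B hB => ?_
  have hset : {C ∈ traceClass 𝒜 T A | C ∩ S = B ∩ S} = traceClass 𝒜 (T ∪ S) B := by
    ext C
    simp only [mem_filter, mem_traceClass, inter_union_eq_iff]
    rw [(mem_traceClass.1 hB).2, and_assoc]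
  have hconst : ∀ C ∈ traceClass 𝒜 (T ∪ S) B,
      p C / #(traceClass 𝒜 (T ∪ S) C) = g (B ∩ S) / #(traceClass 𝒜 (T ∪ S) B) := by
    intro C hC
    have hC' := mem_traceClass.1 hC
    rw [hpg C (mem_filter.1 (hset ▸ hC)).1, traceClass_congr hC'.2,
      (inter_union_eq_iff.1 hC'.2).2]
  have hpos := card_traceClass_pos (S := T ∪ S) (mem_traceClass.1 hB).1
  rw [hset, sum_congr rfl hconst, sum_const, nsmul_eq_mul]
  field_simp

lemma traceEntropy_empty : traceEntropy 𝒜 ∅ = 0 := by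
  simp [traceEntropy, traceClass]

lemma traceEntropy_univ [Fintype V] : traceEntropy 𝒜 univ = #𝒜 * Real.log #𝒜 := by
  have h : ∀ A ∈ 𝒜, Real.log #𝒜 - Real.log #(traceClass 𝒜 univ A) = Real.log #𝒜 := by
    intro A hA
    have : traceClass 𝒜 univ A = {A} := by
      ext B
      simp only [mem_traceClass, inter_univ, mem_singleton]
      exact ⟨fun h => h.2, fun h => ⟨h ▸ hA, h⟩⟩
    simp [this]
  rw [traceEntropy, sum_congr rfl h, sum_const, nsmul_eq_mul]

/-- A single additional coordinate carries at most one bit. -/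
lemma traceEntropy_union_singleton_sub_le (T : Finset V) (u : V) :
    traceEntropy 𝒜 (T ∪ {u}) - traceEntropy 𝒜 T ≤ ∑ _A ∈ 𝒜, Real.log 2 := by
  refine (traceEntropy_sub_le_sum_neg_log (fun _ => 1 / 2) (fun _ _ => by norm_num)
    fun A _ => ?_).trans_eq ?_
  · rw [sum_traceClass_div _ (fun _ => 1 / 2) fun _ _ => rfl]
    have hsub : (traceClass 𝒜 T A).image (· ∩ {u}) ⊆ ({u} : Finset V).powerset := by
      intro X hX
      obtain ⟨B, -, rfl⟩ := mem_image.1 hX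
      exact mem_powerset.2 inter_subset_right
    have hcard := card_le_card hsub
    rw [card_powerset, card_singleton, pow_one] at hcard
    have : (#((traceClass 𝒜 T A).image (· ∩ {u})) : ℝ) ≤ 2 := by exact_mod_cast hcard
    rw [sum_const, nsmul_eq_mul]
    linarith
  · simp

end FamilyEntropy

section BooleanLattice

variable {n : ℕ}

/-- All proper subsets of `v` lie outside the family `A`. -/
def ProperSubsetsAvoid (A : Finset (Finset (Fin n))) (v : Finset (Fin n)) : Prop :=
  ∀ w, w ⊂ v → w ∉ A

/-- The upper sets of the Boolean lattice. -/
noncomputable def upperFamilies (n : ℕ) : Finset (Finset (Finset (Fin n))) := by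
  classical exact {A | IsUpperSet (A : Set (Finset (Fin n)))}

/-- The sets of cardinality less than `i`. -/
def setsBelow (n i : ℕ) : Finset (Finset (Fin n)) := {v | #v < i}

lemma mem_upperFamilies {A : Finset (Finset (Fin n))} :
    A ∈ upperFamilies n ↔ IsUpperSet (A : Set (Finset (Fin n))) := by
  simp [upperFamilies]

lemma mem_setsBelow {i : ℕ} {v : Finset (Fin n)} : v ∈ setsBelow n i ↔ #v < i := by
  simp [setsBelow]

lemma setsBelow_succ (i : ℕ) :
    setsBelow n (i + 1) = setsBelow n i ∪ powersetCard i univ := by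
  ext v
  simp only [mem_setsBelow, mem_union, mem_powersetCard_univ]
  omega

lemma ProperSubsetsAvoid.mono {A : Finset (Finset (Fin n))} {u v : Finset (Fin n)} (huv : u ⊆ v)
    (h : ProperSubsetsAvoid A v) : ProperSubsetsAvoid A u :=
  fun w hw => h w (hw.trans_subset huv)

lemma properSubsetsAvoid_congr {A B : Finset (Finset (Fin n))} {i : ℕ} {u : Finset (Fin n)}
    (hu : #u = i) (h : B ∩ setsBelow n i = A ∩ setsBelow n i) :
    ProperSubsetsAvoid B u ↔ ProperSubsetsAvoid A u := by
  refine forall₂_congr fun w hw => not_congr (mem_iff_of_inter_eq h ?_)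
  exact mem_setsBelow.2 (hu ▸ card_lt_card hw)

lemma properSubsetsAvoid_iff_inter_eq_empty {B : Finset (Finset (Fin n))}
    (hB : B ∈ upperFamilies n) {i : ℕ} {v : Finset (Fin n)} (hv : #v = i + 1) :
    ProperSubsetsAvoid B v ↔ B ∩ powersetCard i v = ∅ := by
  constructor
  · intro h
    refine eq_empty_of_forall_notMem fun u hu => ?_
    obtain ⟨huB, huv⟩ := mem_inter.1 hu
    obtain ⟨huv, hui⟩ := mem_powersetCard.1 huv
    refine h u (huv.ssubset_of_ne ?_) huB
    rintro rfl
    omega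
  · intro h w hw hwB
    obtain ⟨u, hwu, huv, hu⟩ := exists_subsuperset_card_eq hw.subset
      (n := i) (by have := card_lt_card hw; omega) (by omega)
    have : u ∈ B ∩ powersetCard i v :=
      mem_inter.2 ⟨mem_upperFamilies.1 hB hwu hwB, mem_powersetCard.2 ⟨huv, hu⟩⟩
    simp [h] at this

lemma card_filter_mem_powersetCard {i : ℕ} {u : Finset (Fin n)} (hu : #u = i) :
    #{v ∈ powersetCard (i + 1) (univ : Finset (Fin n)) | u ∈ powersetCard i v} = n - i := by
  have h : {v ∈ powersetCard (i + 1) (univ : Finset (Fin n)) | u ∈ powersetCard i v} =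
      uᶜ.image (fun x => insert x u) := by
    ext v
    simp only [mem_filter, mem_powersetCard_univ, mem_image, mem_compl]
    rw [mem_powersetCard]
    constructor
    · rintro ⟨hv, huv, -⟩
      obtain ⟨x, hx⟩ := card_eq_one.1 (show #(v \ u) = 1 by
        rw [card_sdiff_of_subset huv]; omega)
      have hxm : x ∈ v \ u := by simp [hx]
      refine ⟨x, (mem_sdiff.1 hxm).2, ?_⟩
      rw [insert_eq, ← hx, sdiff_union_of_subset huv]
    · rintro ⟨x, hx, rfl⟩
      exact ⟨by rw [card_insert_of_notMem hx, hu], subset_insert x u, hu⟩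
  rw [h, card_image_of_injOn, card_compl, Fintype.card_fin, hu]
  intro x hx y hy hxy
  simp only [coe_compl, Set.mem_compl_iff, mem_coe] at hx hy
  have : x ∈ insert y u := by
    rw [← show insert x u = insert y u from hxy]
    exact mem_insert_self x u
  exact (mem_insert.1 this).resolve_right hx

open Classical in
/-- The sets of cardinality `i` all of whose proper subsets lie outside `A`. -/
noncomputable def freeSets (A : Finset (Finset (Fin n))) (i : ℕ) : Finset (Finset (Fin n)) :=
  {v ∈ powersetCard i univ | ProperSubsetsAvoid A v}

open Classical in
/-- The facets of `v` that are not forced into an upper set by its members of smaller size. -/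
noncomputable def freeFacets (A : Finset (Finset (Fin n))) (i : ℕ) (v : Finset (Fin n)) :
    Finset (Finset (Fin n)) :=
  {u ∈ powersetCard i v | ProperSubsetsAvoid A u}

open Classical in
/-- A conditional distribution for the trace of an upper set on the facets of `v`, given the trace
on all smaller sets. -/
noncomputable def facetWeight (t : ℝ) (i : ℕ) (v : Finset (Fin n)) (A : Finset (Finset (Fin n))) :
    ℝ :=
  if ProperSubsetsAvoid A v then 1 - t
  else (1 / 2) ^ #(freeFacets A i v) * if freeFacets A i v = powersetCard i v then t else 1

lemma facetWeight_pos {t : ℝ} (ht0 : 0 < t) (ht1 : t < 1) (i : ℕ) (v : Finset (Fin n))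
    (A : Finset (Finset (Fin n))) : 0 < facetWeight t i v A := by
  unfold facetWeight
  split_ifs
  · linarith
  · positivity
  · positivity

lemma freeFacets_congr {A B : Finset (Finset (Fin n))} {i : ℕ} {v : Finset (Fin n)}
    (h : B ∩ setsBelow n i = A ∩ setsBelow n i) : freeFacets B i v = freeFacets A i v := by
  classical
  unfold freeFacets
  exact filter_congr fun u hu => properSubsetsAvoid_congr (mem_powersetCard.1 hu).2 h

lemma freeFacets_eq_of_properSubsetsAvoid {A : Finset (Finset (Fin n))} {i : ℕ}
    {v : Finset (Fin n)} (h : ProperSubsetsAvoid A v) :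
    freeFacets A i v = powersetCard i v := by
  classical
  exact filter_true_of_mem fun _ hu => h.mono (mem_powersetCard.1 hu).1

lemma sum_facetWeight_le_one {t : ℝ} (ht0 : 0 < t) (ht1 : t < 1) {i : ℕ} {v : Finset (Fin n)}
    (hv : #v = i + 1) (A : Finset (Finset (Fin n))) :
    ∑ B ∈ traceClass (upperFamilies n) (setsBelow n i) A, facetWeight t i v B /
      #(traceClass (upperFamilies n) (setsBelow n i ∪ powersetCard i v) B) ≤ 1 := by
  classical
  set 𝒯 := traceClass (upperFamilies n) (setsBelow n i) A
  set N := powersetCard i v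
  by_cases hR : freeFacets A i v = N
  · rw [sum_traceClass_div _ (fun X => if X = ∅ then 1 - t else (1 / 2) ^ #N * t)]
    · calc ∑ X ∈ 𝒯.image (· ∩ N), (if X = ∅ then 1 - t else (1 / 2) ^ #N * t)
          ≤ ∑ X ∈ N.powerset, (if X = ∅ then 1 - t else (1 / 2) ^ #N * t) := by
            refine sum_le_sum_of_subset_of_nonneg ?_ fun X _ _ => ?_
            · intro X hX
              obtain ⟨B, -, rfl⟩ := mem_image.1 hX
              exact mem_powerset.2 inter_subset_right
            · split_ifs
              · linarith
              · positivity
        _ ≤ ∑ X ∈ N.powerset, ((if X = ∅ then 1 - t else 0) + (1 / 2) ^ #N * t) := by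
            refine sum_le_sum fun X _ => ?_
            have : 0 < (1 / 2 : ℝ) ^ #N * t := by positivity
            split_ifs <;> linarith
        _ = 1 := by
            rw [sum_add_distrib, sum_ite_eq' N.powerset ∅, if_pos (empty_mem_powerset N),
              sum_const, card_powerset, nsmul_eq_mul]
            push_cast
            rw [← mul_assoc, ← mul_pow]
            norm_num
    · intro B hB
      obtain ⟨hB, hBA⟩ := mem_traceClass.1 hB
      simp only [facetWeight, freeFacets_congr hBA, hR, if_true,
        properSubsetsAvoid_iff_inter_eq_empty hB hv, N]
  · rw [sum_traceClass_div _ (fun _ => (1 / 2) ^ #(freeFacets A i v))]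
    · have hsub : 𝒯.image (· ∩ N) ⊆
          (freeFacets A i v).powerset.image (· ∪ (N \ freeFacets A i v)) := by
        intro X hX
        obtain ⟨B, hB, rfl⟩ := mem_image.1 hX
        obtain ⟨hB, hBA⟩ := mem_traceClass.1 hB
        refine mem_image.2 ⟨B ∩ freeFacets A i v, mem_powerset.2 inter_subset_right, ?_⟩
        ext u
        have h1 : u ∈ freeFacets A i v → u ∈ N := fun h => (mem_filter.1 h).1
        have h2 : u ∈ N → u ∉ freeFacets A i v → u ∈ B := by
          intro hu hnu
          rw [← freeFacets_congr hBA, freeFacets, mem_filter, not_and] at hnu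
          have := hnu hu
          simp only [ProperSubsetsAvoid, not_forall, not_not] at this
          obtain ⟨w, hwu, hwB⟩ := this
          exact mem_upperFamilies.1 hB hwu.subset hwB
        simp only [mem_union, mem_inter, mem_sdiff]
        tauto
      have hcard := (card_le_card hsub).trans card_image_le
      rw [card_powerset] at hcard
      have hcard' : (#(𝒯.image (· ∩ N)) : ℝ) ≤ 2 ^ #(freeFacets A i v) := by exact_mod_cast hcard
      rw [sum_const, nsmul_eq_mul]
      calc _ ≤ (2 : ℝ) ^ #(freeFacets A i v) * (1 / 2) ^ #(freeFacets A i v) := by gcongr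
        _ = 1 := by rw [← mul_pow]; norm_num
    · intro B hB
      obtain ⟨hB, hBA⟩ := mem_traceClass.1 hB
      have hq : ¬ ProperSubsetsAvoid B v := fun h =>
        hR ((freeFacets_congr hBA).symm.trans (freeFacets_eq_of_properSubsetsAvoid h))
      rw [facetWeight, if_neg hq, freeFacets_congr hBA, if_neg hR, mul_one]

lemma card_facets {i : ℕ} {v : Finset (Fin n)} (hv : #v = i + 1) :
    #(powersetCard i v) = i + 1 := by
  rw [card_powersetCard, hv, Nat.choose_succ_self_right]

open Classical in
lemma neg_log_facetWeight_le {t : ℝ} (ht0 : 0 < t) (ht1 : t < 1) {i : ℕ} {v : Finset (Fin n)}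
    (hv : #v = i + 1) (A : Finset (Finset (Fin n))) :
    -Real.log (facetWeight t i v A) ≤
      (if ProperSubsetsAvoid A v then 1 else 0) * -Real.log (1 - t) +
      (#(freeFacets A i v) - (i + 1) * if ProperSubsetsAvoid A v then 1 else 0) *
        (Real.log 2 + -Real.log t / (i + 1)) := by
  have hlt : 0 < -Real.log t := by have := Real.log_neg ht0 ht1; linarith
  have hl2 := Real.log_pos (show (1 : ℝ) < 2 by norm_num)
  have hi : (0 : ℝ) < i + 1 := by positivity
  unfold facetWeight
  split_ifs with hq hR
  · rw [freeFacets_eq_of_properSubsetsAvoid hq, card_facets hv]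
    push_cast
    linarith
  · rw [Real.log_mul (by positivity) ht0.ne', Real.log_pow, hR, card_facets hv, one_div,
      Real.log_inv]
    push_cast
    field_simp
    linarith
  · rw [mul_one, Real.log_pow, one_div, Real.log_inv]
    have : 0 ≤ (#(freeFacets A i v) : ℝ) * (-Real.log t / (i + 1)) := by positivity
    linarith

lemma sum_card_freeFacets (A : Finset (Finset (Fin n))) (i : ℕ) :
    ∑ v ∈ powersetCard (i + 1) (univ : Finset (Fin n)), #(freeFacets A i v) =
      (n - i) * #(freeSets A i) := by
  classical
  calc ∑ v ∈ powersetCard (i + 1) (univ : Finset (Fin n)), #(freeFacets A i v)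
      = ∑ v ∈ powersetCard (i + 1) (univ : Finset (Fin n)), ∑ u ∈ freeFacets A i v, 1 := by simp
    _ = ∑ u ∈ freeSets A i,
        ∑ v ∈ powersetCard (i + 1) (univ : Finset (Fin n)) with u ∈ powersetCard i v, 1 := by
        refine sum_comm' fun v u => ?_
        simp only [freeFacets, freeSets, mem_filter, mem_powersetCard, subset_univ, true_and]
        tauto
    _ = ∑ u ∈ freeSets A i, (n - i) := by
        refine sum_congr rfl fun u hu => ?_
        rw [← card_eq_sum_ones, card_filter_mem_powersetCard
          (mem_powersetCard_univ.1 (mem_filter.1 hu).1)]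
    _ = _ := by rw [sum_const, smul_eq_mul, mul_comm]

/-- The proportion of the sets of cardinality `i` all of whose proper subsets lie outside `A`. -/
noncomputable def freeDensity (A : Finset (Finset (Fin n))) (i : ℕ) : ℝ :=
  #(freeSets A i) / n.choose i

lemma freeDensity_nonneg (A : Finset (Finset (Fin n))) (i : ℕ) : 0 ≤ freeDensity A i := by
  unfold freeDensity; positivity

lemma freeDensity_le_one (A : Finset (Finset (Fin n))) (i : ℕ) : freeDensity A i ≤ 1 := by
  classical
  refine div_le_one_of_le₀ ?_ (by positivity)
  have : #(freeSets A i) ≤ #(powersetCard i (univ : Finset (Fin n))) := card_filter_le _ _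
  rw [card_powersetCard, card_univ, Fintype.card_fin] at this
  exact_mod_cast this

lemma choose_mul_freeDensity (A : Finset (Finset (Fin n))) {i : ℕ} (hi : i ≤ n) :
    n.choose i * freeDensity A i = #(freeSets A i) := by
  have : (n.choose i : ℝ) ≠ 0 := by exact_mod_cast (Nat.choose_pos hi).ne'
  unfold freeDensity
  field_simp

lemma choose_succ_mul_succ_real {i : ℕ} (hi : i < n) :
    (n.choose (i + 1) : ℝ) * (i + 1) = n.choose i * (n - i) := by
  have := Nat.choose_succ_right_eq n i
  rw [← Nat.cast_sub hi.le]
  exact_mod_cast this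

lemma freeDensity_succ_le (A : Finset (Finset (Fin n))) {i : ℕ} (hi : i < n) :
    freeDensity A (i + 1) ≤ freeDensity A i := by
  classical
  have hsum : (i + 1) * #(freeSets A (i + 1)) ≤ (n - i) * #(freeSets A i) := by
    rw [← sum_card_freeFacets]
    calc (i + 1) * #(freeSets A (i + 1))
        = ∑ v ∈ freeSets A (i + 1), #(freeFacets A i v) := by
          rw [mul_comm, ← smul_eq_mul, ← sum_const]
          refine sum_congr rfl fun v hv => ?_
          obtain ⟨hv, hq⟩ := mem_filter.1 hv
          rw [freeFacets_eq_of_properSubsetsAvoid hq, card_facets (mem_powersetCard_univ.1 hv)]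
      _ ≤ _ := sum_le_sum_of_subset (filter_subset _ _)
  have hsum' : ((i : ℝ) + 1) * #(freeSets A (i + 1)) ≤ (n - i) * #(freeSets A i) := by
    rw [← Nat.cast_sub hi.le]
    exact_mod_cast hsum
  rw [← choose_mul_freeDensity A hi, ← choose_mul_freeDensity A hi.le] at hsum'
  have hc := choose_succ_mul_succ_real hi
  have hpos : (0 : ℝ) < n.choose i * (n - i) :=
    mul_pos (by exact_mod_cast Nat.choose_pos hi.le) (sub_pos.2 (by exact_mod_cast hi))
  refine le_of_mul_le_mul_left ?_ hpos
  calc _ = ((i : ℝ) + 1) * (n.choose (i + 1) * freeDensity A (i + 1)) := by rw [← hc]; ring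
    _ ≤ _ := hsum'
    _ = _ := by ring

lemma choose_div_succ_le (i : ℕ) :
    (n.choose i : ℝ) / (i + 1) ≤ 2 * n.choose (n / 2) / (n + 1) := by
  rw [div_le_div_iff₀ (by positivity) (by positivity)]
  have h1 := Nat.add_one_mul_choose_eq n i
  have h2 : (n + 1).choose (i + 1) ≤ 2 * n.choose (n / 2) := by
    rw [Nat.choose_succ_succ']
    have := Nat.choose_le_middle i n
    have := Nat.choose_le_middle (i + 1) n
    omega
  have h3 : n.choose i * (n + 1) ≤ 2 * n.choose (n / 2) * (i + 1) := by
    calc n.choose i * (n + 1) = (n + 1).choose (i + 1) * (i + 1) := by rw [← h1]; ring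
      _ ≤ _ := by gcongr
  exact_mod_cast h3

/-- The entropy of one level of a random upper set, given all lower levels. -/
lemma traceEntropy_setsBelow_succ_sub_le {t : ℝ} (ht0 : 0 < t) (ht1 : t < 1) {i : ℕ}
    (hi : i < n) :
    traceEntropy (upperFamilies n) (setsBelow n (i + 1)) -
        traceEntropy (upperFamilies n) (setsBelow n i) ≤
      ∑ A ∈ upperFamilies n, ((freeDensity A i - freeDensity A (i + 1)) *
        (n.choose (n / 2) * Real.log 2 + 2 * n.choose (n / 2) / (n + 1) * -Real.log t) +
        2 * n.choose (n / 2) / (n + 1) * -Real.log (1 - t)) := by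
  classical
  have hlt : 0 < -Real.log t := by have := Real.log_neg ht0 ht1; linarith
  have hlt' : 0 < -Real.log (1 - t) := by
    have := Real.log_neg (x := 1 - t) (by linarith) (by linarith); linarith
  have hl2 := Real.log_pos (show (1 : ℝ) < 2 by norm_num)
  have hni : (0 : ℝ) < n - i := sub_pos.2 (by exact_mod_cast hi)
  have hshearer := mul_traceEntropy_union_sub_le (𝒜 := upperFamilies n)
    (powersetCard (i + 1) univ) (fun v => powersetCard i v) (n - i) (setsBelow n i)
    (powersetCard i univ)
    fun u hu => card_filter_mem_powersetCard (mem_powersetCard_univ.1 hu)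
  rw [← setsBelow_succ, Nat.cast_sub hi.le] at hshearer
  refine le_of_mul_le_mul_left (hshearer.trans ?_) hni
  calc _ ≤ ∑ v ∈ powersetCard (i + 1) (univ : Finset (Fin n)), ∑ A ∈ upperFamilies n,
        -Real.log (facetWeight t i v A) := by
        refine sum_le_sum fun v hv => ?_
        rw [inter_eq_left.2 (powersetCard_mono (subset_univ v))]
        exact traceEntropy_sub_le_sum_neg_log _ (fun A _ => facetWeight_pos ht0 ht1 i v A)
          fun A _ => sum_facetWeight_le_one ht0 ht1 (mem_powersetCard_univ.1 hv) A
    _ = ∑ A ∈ upperFamilies n, ∑ v ∈ powersetCard (i + 1) (univ : Finset (Fin n)),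
        -Real.log (facetWeight t i v A) := sum_comm
    _ ≤ _ := ?_
  rw [mul_sum]
  refine sum_le_sum fun A _ => ?_
  refine (sum_le_sum fun v hv =>
    neg_log_facetWeight_le ht0 ht1 (mem_powersetCard_univ.1 hv) A).trans ?_
  have hcount : ∑ v ∈ powersetCard (i + 1) (univ : Finset (Fin n)),
      (if ProperSubsetsAvoid A v then (1 : ℝ) else 0) = #(freeSets A (i + 1)) := by
    rw [← sum_filter, sum_const, nsmul_eq_mul, mul_one, freeSets]
  have hfacets : ∑ v ∈ powersetCard (i + 1) (univ : Finset (Fin n)),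
      (#(freeFacets A i v) : ℝ) = (n - i) * #(freeSets A i) := by
    rw [← Nat.cast_sub hi.le]
    exact_mod_cast sum_card_freeFacets A i
  rw [sum_add_distrib, ← sum_mul, ← sum_mul, sum_sub_distrib, ← mul_sum, hcount, hfacets,
    ← choose_mul_freeDensity A hi, ← choose_mul_freeDensity A hi.le]
  have hc := choose_succ_mul_succ_real hi
  have hc' : (n.choose (i + 1) : ℝ) = (n - i) * (n.choose i / (i + 1)) := by
    field_simp; linarith
  have hd := sub_nonneg.2 (freeDensity_succ_le A hi)
  have hdiv := choose_div_succ_le (n := n) i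
  have hmid : (n.choose i : ℝ) ≤ n.choose (n / 2) := by exact_mod_cast Nat.choose_le_middle i n
  calc _ = (n - i) * ((freeDensity A i - freeDensity A (i + 1)) *
        (n.choose i * Real.log 2 + n.choose i / (i + 1) * -Real.log t) +
        n.choose i / (i + 1) * -Real.log (1 - t) * freeDensity A (i + 1)) := by
        rw [hc']; field_simp; ring
    _ ≤ (n - i) * ((freeDensity A i - freeDensity A (i + 1)) *
        (n.choose i * Real.log 2 + n.choose i / (i + 1) * -Real.log t) +
        n.choose i / (i + 1) * -Real.log (1 - t) * 1) := by
        have := freeDensity_le_one A (i + 1)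
        gcongr
    _ ≤ _ := by
        rw [mul_one]
        gcongr

/-- The number of upper sets of the Boolean lattice. -/
lemma log_card_upperFamilies_le (hn : 1 ≤ n) :
    Real.log #(upperFamilies n) ≤ n.choose (n / 2) * Real.log 2 +
      2 * n.choose (n / 2) / (n + 1) * (Real.log (n + 1) + 1) + Real.log 2 := by
  have hn0 : (0 : ℝ) < n := by exact_mod_cast hn
  set t : ℝ := 1 / (n + 1) with ht
  have ht0 : 0 < t := by positivity
  have ht1 : t < 1 := by rw [ht, div_lt_one (by positivity)]; linarith
  have hlogt : -Real.log t = Real.log (n + 1) := by rw [ht, one_div, Real.log_inv, neg_neg]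
  have hlogt' : n * -Real.log (1 - t) ≤ 1 := by
    have h1 : 1 - t = ((n + 1) / n : ℝ)⁻¹ := by rw [ht]; field_simp; ring
    have h2 := Real.log_le_sub_one_of_pos (show (0 : ℝ) < (n + 1) / n by positivity)
    rw [h1, Real.log_inv, neg_neg]
    calc n * Real.log ((n + 1) / n) ≤ n * ((n + 1) / n - 1) := by gcongr
      _ = 1 := by field_simp; ring
  set 𝒜 := upperFamilies n
  set M : ℝ := (n.choose (n / 2) : ℝ)
  have hM : 0 ≤ M := by positivity
  have hl2 := Real.log_pos (show (1 : ℝ) < 2 by norm_num)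
  have hlog : 0 ≤ Real.log (n + 1) := Real.log_nonneg (by linarith)
  have hlevels : traceEntropy 𝒜 (setsBelow n n) ≤
      ∑ A ∈ 𝒜, (M * Real.log 2 + 2 * M / (n + 1) * (Real.log (n + 1) + 1)) := by
    have h0 : setsBelow n 0 = ∅ := by simp [setsBelow]
    rw [← sub_zero (traceEntropy 𝒜 (setsBelow n n)), ← traceEntropy_empty (𝒜 := 𝒜), ← h0,
      ← sum_range_sub (fun i => traceEntropy 𝒜 (setsBelow n i))]
    refine (sum_le_sum fun i hi =>
      traceEntropy_setsBelow_succ_sub_le ht0 ht1 (mem_range.1 hi)).trans ?_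
    rw [sum_comm]
    refine sum_le_sum fun A _ => ?_
    rw [sum_add_distrib, ← sum_mul, sum_range_sub' (freeDensity A), sum_const, card_range,
      nsmul_eq_mul, hlogt]
    have hd : freeDensity A 0 - freeDensity A n ≤ 1 := by
      linarith [freeDensity_le_one A 0, freeDensity_nonneg A n]
    calc _ ≤ 1 * (M * Real.log 2 + 2 * M / (n + 1) * Real.log (n + 1)) +
          2 * M / (n + 1) * (n * -Real.log (1 - t)) := by
          rw [mul_left_comm (n : ℝ)]
          gcongr
      _ ≤ 1 * (M * Real.log 2 + 2 * M / (n + 1) * Real.log (n + 1)) + 2 * M / (n + 1) * 1 := by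
          gcongr
      _ = _ := by ring
  have htop := traceEntropy_union_singleton_sub_le (𝒜 := 𝒜) (setsBelow n n) univ
  have huniv : setsBelow n n ∪ {univ} = univ := by
    refine eq_univ_of_forall fun v => ?_
    rw [mem_union, mem_setsBelow, mem_singleton, ← card_eq_iff_eq_univ, Fintype.card_fin]
    have := card_le_univ v
    rw [Fintype.card_fin] at this
    omega
  rw [huniv, traceEntropy_univ] at htop
  have hne : (0 : ℝ) < #𝒜 := by
    have : (∅ : Finset (Finset (Fin n))) ∈ 𝒜 := mem_upperFamilies.2 (by simp [isUpperSet_empty])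
    exact_mod_cast card_pos.2 ⟨_, this⟩
  rw [sum_const, nsmul_eq_mul] at hlevels htop
  refine le_of_mul_le_mul_left ?_ hne
  rw [mul_add]
  linarith

/-- An antichain is determined by the upper set it generates. -/
lemma alphaBool_le_card_upperFamilies (n : ℕ) : alphaBool n ≤ #(upperFamilies n) := by
  classical
  have hmem (A : Finset (Finset (Fin n))) :
      ({x | x ∈ upperClosure (A : Set (Finset (Fin n)))} : Finset _) ∈ upperFamilies n := by
    rw [mem_upperFamilies]
    intro x y hxy hx
    simp only [coe_filter, mem_univ, true_and, Set.mem_ofPred_eq] at hx ⊢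
    exact (upperClosure (A : Set (Finset (Fin n)))).upper hxy hx
  rw [alphaBool, ← Fintype.card_coe, ← Nat.card_eq_fintype_card]
  refine Nat.card_le_card_of_injective (fun A => ⟨_, hmem A.1⟩) fun A B hAB => ?_
  have hiff : ∀ x, x ∈ upperClosure (A.1 : Set (Finset (Fin n))) ↔
      x ∈ upperClosure (B.1 : Set (Finset (Fin n))) := by
    simpa [Finset.ext_iff] using hAB
  ext x
  rw [← mem_coe, ← mem_coe, ← A.2.minimal_mem_upperClosure_iff_mem,
    ← B.2.minimal_mem_upperClosure_iff_mem]
  simp only [hiff]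

end BooleanLattice

theorem stmt1 :
    ∃ C : ℝ, 0 < C ∧ ∀ n : ℕ, 2 ≤ n →
      Real.logb 2 (alphaBool n) ≤
        (1 + C * Real.logb 2 n / n) * (n.choose (n / 2)) := by
  refine ⟨8, by norm_num, fun n hn => ?_⟩
  have hn' : (2 : ℝ) ≤ n := by exact_mod_cast hn
  have hn0 : (0 : ℝ) < n := by linarith
  have hl2 := Real.log_pos (show (1 : ℝ) < 2 by norm_num)
  have hpos : 0 < alphaBool n := by
    have : Nonempty {A : Finset (Finset (Fin n)) //
        IsAntichain (· ⊆ ·) (A : Set (Finset (Fin n)))} := ⟨⟨∅, by simp⟩⟩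
    exact Nat.card_pos
  have hle : Real.log (alphaBool n) ≤ Real.log #(upperFamilies n) :=
    Real.log_le_log (by exact_mod_cast hpos) (by exact_mod_cast alphaBool_le_card_upperFamilies n)
  have hbound := hle.trans (log_card_upperFamilies_le (by omega))
  set M : ℝ := (n.choose (n / 2) : ℝ)
  have hM : (n : ℝ) ≤ M := by
    have := Nat.choose_le_middle 1 n
    rw [Nat.choose_one_right] at this
    exact Nat.cast_le.2 this
  have hlogn : Real.log 2 ≤ Real.log n := Real.log_le_log (by norm_num) hn'
  have hlog1 : Real.log (n + 1) ≤ 2 * Real.log n := by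
    rw [← Real.log_rpow hn0]
    refine Real.log_le_log (by linarith) ?_
    norm_cast
    nlinarith
  have hhalf : (1 : ℝ) ≤ 3 / 2 * Real.log 2 := by linarith [Real.log_two_gt_d9]
  have hmain : Real.log (alphaBool n) ≤ M * Real.log 2 + M / n * (8 * Real.log n) := by
    have hM0 : 0 ≤ M := by linarith
    have h1 : 2 * M / (n + 1) * (Real.log (n + 1) + 1) ≤
        2 * M / n * (2 * Real.log n + 3 / 2 * Real.log n) := by
      have : 0 ≤ Real.log (n + 1) := Real.log_nonneg (by linarith)
      gcongr
      · linarith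
      · linarith
    have h2 : Real.log 2 ≤ M / n * Real.log n :=
      hlogn.trans (le_mul_of_one_le_left (by linarith) ((one_le_div hn0).2 hM))
    calc _ ≤ M * Real.log 2 + 2 * M / n * (2 * Real.log n + 3 / 2 * Real.log n) +
          M / n * Real.log n := by linarith
      _ = _ := by ring
  rw [Real.logb, Real.logb, div_le_iff₀ hl2]
  refine hmain.trans_eq ?_
  field_simp
end

section
/- For every integer q ≥ 2 there exists a constant C_q > 0 such that the following holds: for every integer d ≥ 1 and every d-regular bipartite graph G on m vertices, the number c_q(G) of proper q-colorings of G satisfies log₂ c_q(G) ≤ (m/2) · ( log₂(⌊q/2⌋·⌈q/2⌉) + C_q/d ). -/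
open MeasureTheory Finset
open scoped ENNReal

/-- The number of proper `q`-colorings of a graph `G`. -/
noncomputable def numColorings (q : ℕ) {V : Type*} (G : SimpleGraph V) : ℕ :=
  Nat.card (G.Coloring (Fin q))

/-- **Finner's inequality** for marginals: if `f b` depends only on the coordinates in `S b`, and
the weights `p b` of the sets `S b` containing any given coordinate sum to `1`, then the integral
of `∏ b, f b ^ p b` is at most the product of the powers of the integrals of the `f b`. -/
theorem lmarginal_prod_rpow_le {δ β : Type*} [DecidableEq δ] [Fintype β] {X : δ → Type*}
    [∀ i, MeasurableSpace (X i)] (μ : ∀ i, Measure (X i)) [∀ i, SigmaFinite (μ i)]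
    (S : β → Finset δ) {f : β → (∀ i, X i) → ℝ≥0∞} (hf : ∀ b, Measurable (f b))
    (hfS : ∀ b, ∀ i ∉ S b, ∀ x y, f b (Function.update x i y) = f b x)
    {p : β → ℝ} (hp : ∀ b, 0 ≤ p b) (T : Finset δ) (hT : ∀ i ∈ T, ∑ b with i ∈ S b, p b = 1)
    (x : ∀ i, X i) :
    (∫⋯∫⁻_T, (fun x ↦ ∏ b, f b x ^ p b) ∂μ) x ≤
      ∏ b, ((∫⋯∫⁻_{i ∈ T | i ∈ S b}, f b ∂μ) x) ^ p b := by
  induction T using Finset.induction generalizing x with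
  | empty => simp
  | insert a T ha ih =>
    have hm : Measurable fun x ↦ ∏ b, f b x ^ p b :=
      Finset.measurable_prod _ fun b _ ↦ (hf b).pow_const _
    rw [lmarginal_insert _ hm ha]
    set F : β → X a → ℝ≥0∞ :=
      fun b t ↦ (∫⋯∫⁻_{i ∈ T | i ∈ S b}, f b ∂μ) (Function.update x a t) with hF
    have hFm : ∀ b, Measurable (F b) := fun b ↦
      ((hf b).lmarginal μ).comp (measurable_update x)
    have hconst : ∀ b, a ∉ S b → ∀ t, F b t = (∫⋯∫⁻_{i ∈ T | i ∈ S b}, f b ∂μ) x := by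
      intro b hb t
      rw [hF]
      dsimp only
      rw [lmarginal_update_of_notMem (hf b) (by simp [hb])]
      have : f b ∘ (Function.update · a t) = f b := funext fun z ↦ hfS b a hb z t
      rw [this]
    calc ∫⁻ t, (∫⋯∫⁻_T, (fun x ↦ ∏ b, f b x ^ p b) ∂μ) (Function.update x a t) ∂μ a
        ≤ ∫⁻ t, ∏ b, F b t ^ p b ∂μ a :=
          lintegral_mono fun t ↦ ih (fun i hi ↦ hT i (mem_insert_of_mem hi)) _
      _ = ∫⁻ t, (∏ b with a ∈ S b, F b t ^ p b) *
            ∏ b with a ∉ S b, ((∫⋯∫⁻_{i ∈ T | i ∈ S b}, f b ∂μ) x) ^ p b ∂μ a := by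
          refine lintegral_congr fun t ↦ ?_
          rw [← prod_filter_mul_prod_filter_not univ (fun b ↦ a ∈ S b)]
          congr 1
          exact prod_congr rfl fun b hb ↦ by rw [hconst b (mem_filter.1 hb).2]
      _ = (∫⁻ t, ∏ b with a ∈ S b, F b t ^ p b ∂μ a) *
            ∏ b with a ∉ S b, ((∫⋯∫⁻_{i ∈ T | i ∈ S b}, f b ∂μ) x) ^ p b :=
          lintegral_mul_const _ (Finset.measurable_prod _ fun b _ ↦ (hFm b).pow_const _)
      _ ≤ (∏ b with a ∈ S b, (∫⁻ t, F b t ∂μ a) ^ p b) *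
            ∏ b with a ∉ S b, ((∫⋯∫⁻_{i ∈ T | i ∈ S b}, f b ∂μ) x) ^ p b := by
          gcongr
          exact ENNReal.lintegral_prod_norm_pow_le _ (fun b _ ↦ (hFm b).aemeasurable)
            (hT a (mem_insert_self a T)) fun b _ ↦ hp b
      _ = ∏ b, ((∫⋯∫⁻_{i ∈ insert a T | i ∈ S b}, f b ∂μ) x) ^ p b := by
          rw [← prod_filter_mul_prod_filter_not univ (fun b ↦ a ∈ S b)
            (fun b ↦ ((∫⋯∫⁻_{i ∈ insert a T | i ∈ S b}, f b ∂μ) x) ^ p b)]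
          congr 1
          · refine prod_congr rfl fun b hb ↦ ?_
            rw [filter_insert, if_pos (mem_filter.1 hb).2,
              lmarginal_insert _ (hf b) (by simp [ha])]
          · refine prod_congr rfl fun b hb ↦ ?_
            rw [filter_insert, if_neg (mem_filter.1 hb).2]

theorem lintegral_pi_count {ι α : Type*} [Fintype ι] [DecidableEq ι] [Fintype α] [MeasurableSpace α]
    [MeasurableSingletonClass α] (f : (ι → α) → ℝ≥0∞) :
    ∫⁻ x, f x ∂Measure.pi (fun _ : ι ↦ (Measure.count : Measure α)) = ∑ x, f x := by
  rw [lintegral_fintype]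
  simp [Measure.pi_singleton]

theorem mul_sub_le_half_mul_half {q k : ℕ} (hk : k ≤ q) :
    k * (q - k) ≤ q / 2 * ((q + 1) / 2) := by
  obtain ⟨l, rfl⟩ := Nat.exists_eq_add_of_le hk
  rw [Nat.add_sub_cancel_left]
  obtain ⟨n, hn | hn⟩ := Nat.even_or_odd' (k + l)
  · have h1 : (k + l) / 2 = n := by omega
    have h2 : (k + l + 1) / 2 = n := by omega
    rw [h1, h2]
    zify at *
    nlinarith [sq_nonneg ((k : ℤ) - l)]
  · have h1 : (k + l) / 2 = n := by omega
    have h2 : (k + l + 1) / 2 = n + 1 := by omega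
    rw [h1, h2]
    rcases le_total k n with h | h
    · obtain ⟨r, rfl⟩ := Nat.exists_eq_add_of_le h
      obtain rfl : l = k + 2 * r + 1 := by omega
      nlinarith
    · obtain rfl | h := h.eq_or_lt
      · obtain rfl : l = n + 1 := by omega
        exact le_rfl
      · obtain ⟨r, rfl⟩ := Nat.exists_eq_add_of_lt h
        obtain rfl : n = l + r := by omega
        nlinarith

/-- An upper bound for the number of proper `q`-colorings of the complete bipartite graph. -/
theorem sum_card_avoiding_pow_le {ι : Type*} [Fintype ι] [DecidableEq ι] (q : ℕ) :
    ∑ y : ι → Fin q, #{c | ∀ a, y a ≠ c} ^ Fintype.card ι ≤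
      2 ^ q * (q / 2 * ((q + 1) / 2)) ^ Fintype.card ι := by
  calc ∑ y : ι → Fin q, #{c | ∀ a, y a ≠ c} ^ Fintype.card ι
      ≤ ∑ y : ι → Fin q, ∑ A : Finset (Fin q),
          if ∀ a, y a ∈ A then #Aᶜ ^ Fintype.card ι else 0 := by
        refine sum_le_sum fun y _ ↦ ?_
        have h := single_le_sum (s := univ) (f := fun A : Finset (Fin q) ↦
          if ∀ a, y a ∈ A then #Aᶜ ^ Fintype.card ι else 0) (fun _ _ ↦ Nat.zero_le _)
          (mem_univ (univ.image y))
        refine le_trans (le_of_eq ?_) h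
        rw [if_pos (by simp)]
        congr 2
        ext c
        simp
    _ = ∑ A : Finset (Fin q), (#A * (q - #A)) ^ Fintype.card ι := by
        rw [sum_comm]
        refine sum_congr rfl fun A _ ↦ ?_
        rw [← sum_filter, sum_const, smul_eq_mul, mul_pow, card_compl, Fintype.card_fin]
        congr 1
        have : ({y : ι → Fin q | ∀ a, y a ∈ A} : Finset _) = Fintype.piFinset fun _ ↦ A := by
          ext y
          simp
        rw [this, Fintype.card_piFinset, prod_const, card_univ]
    _ ≤ ∑ _A : Finset (Fin q), (q / 2 * ((q + 1) / 2)) ^ Fintype.card ι :=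
        sum_le_sum fun A _ ↦ Nat.pow_le_pow_left
          (mul_sub_le_half_mul_half (by simpa using card_le_univ A)) _
    _ = 2 ^ q * (q / 2 * ((q + 1) / 2)) ^ Fintype.card ι := by simp

/-- The extension count for colorings of one side of a biregular bipartite incidence relation. -/
theorem sum_prod_card_avoiding_le {A B : Type*} [Fintype A] [Fintype B] [DecidableEq A]
    (S : B → Finset A) {q d : ℕ} (hq : 2 ≤ q) (hd : 1 ≤ d) (hS : ∀ b, #(S b) = d)
    (hA : ∀ a, #{b | a ∈ S b} = d) :
    ((∑ x : A → Fin q, ∏ b, #{c | ∀ a ∈ S b, x a ≠ c} : ℕ) : ℝ≥0∞) ≤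
      (((2 ^ q * (q / 2 * ((q + 1) / 2)) ^ d : ℕ) : ℝ≥0∞) ^ (1 / d : ℝ)) ^ Fintype.card B := by
  have hd0 : (d : ℝ) ≠ 0 := by positivity
  let x₀ : A → Fin q := fun _ ↦ ⟨0, by omega⟩
  set f : B → (A → Fin q) → ℝ≥0∞ := fun b x ↦ ((#{c | ∀ a ∈ S b, x a ≠ c} ^ d : ℕ) : ℝ≥0∞)
    with hf
  have key := lmarginal_prod_rpow_le (fun _ : A ↦ (Measure.count : Measure (Fin q))) S (f := f)
    (fun _ ↦ .of_discrete) (fun b i hi x y ↦ by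
      have h : ∀ a ∈ S b, Function.update x i y a = x a := fun a ha ↦
        Function.update_of_ne (by rintro rfl; exact hi ha) _ _
      simp only [hf]
      congr 3
      ext c
      simp +contextual [h])
    (p := fun _ ↦ (1 / d : ℝ)) (fun _ ↦ by positivity) univ (fun a _ ↦ by
      rw [sum_const, hA, nsmul_eq_mul]
      field_simp) x₀
  rw [lmarginal_univ, lintegral_pi_count] at key
  refine le_trans (le_of_eq ?_) (key.trans ?_)
  · push_cast
    refine sum_congr rfl fun x _ ↦ prod_congr rfl fun b _ ↦ ?_
    simp only [hf]
    rw [Nat.cast_pow, ← ENNReal.rpow_natCast, ← ENNReal.rpow_mul, mul_one_div_cancel hd0,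
      ENNReal.rpow_one]
  · rw [← card_univ, ← prod_const]
    refine prod_le_prod' fun b _ ↦ ENNReal.rpow_le_rpow ?_ (by positivity)
    have hfil : ({i ∈ univ | i ∈ S b} : Finset A) = S b := by simp
    rw [hfil, lmarginal, lintegral_pi_count]
    have h := sum_card_avoiding_pow_le (ι := S b) q
    rw [Fintype.card_coe, hS] at h
    refine le_trans (le_of_eq ?_) (Nat.cast_le.2 h)
    push_cast
    refine sum_congr rfl fun y _ ↦ ?_
    simp only [hf, Nat.cast_pow]
    congr 3
    ext c
    simp only [mem_filter, mem_univ, true_and, Subtype.forall]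
    refine forall₂_congr fun a ha ↦ ?_
    rw [Function.updateFinset, dif_pos ha]

theorem numColorings_le_sum_prod {V : Type*} [Fintype V] [DecidableEq V] (G : SimpleGraph V) (q : ℕ)
    (P : V → Prop) [DecidablePred P] [DecidableRel G.Adj] :
    numColorings q G ≤ ∑ x : {v // P v} → Fin q, ∏ b : {v // ¬ P v},
      #{c | ∀ a ∈ ({a | G.Adj a b} : Finset {v // P v}), x a ≠ c} := by
  let E := Σ x : {v // P v} → Fin q, ∀ b : {v // ¬ P v},
    {c : Fin q // c ∈ ({c | ∀ a ∈ ({a | G.Adj a b} : Finset {v // P v}), x a ≠ c} : Finset _)}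
  let F : G.Coloring (Fin q) → E := fun C ↦ ⟨fun a ↦ C a, fun b ↦ ⟨C b, by
    simp only [mem_filter, mem_univ, true_and]
    exact fun a ha ↦ C.valid ha⟩⟩
  have hF : Function.Injective F := by
    intro C D h
    have h1 : (fun a : {v // P v} ↦ C a) = fun a : {v // P v} ↦ D a := congrArg Sigma.fst h
    have h2 : (fun b : {v // ¬ P v} ↦ C b) = fun b : {v // ¬ P v} ↦ D b :=
      congrArg (fun e : E ↦ fun b ↦ (e.2 b : Fin q)) h
    ext v
    by_cases hv : P v
    · exact congrArg Fin.val (congrFun h1 ⟨v, hv⟩)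
    · exact congrArg Fin.val (congrFun h2 ⟨v, hv⟩)
  calc numColorings q G ≤ Nat.card E := Nat.card_le_card_of_injective F hF
    _ = _ := by
      rw [Nat.card_eq_fintype_card, Fintype.card_sigma]
      refine sum_congr rfl fun x _ ↦ ?_
      rw [Fintype.card_pi]
      exact prod_congr rfl fun b _ ↦ Fintype.card_coe _

theorem card_subtype_adj {V : Type*} [Fintype V] (G : SimpleGraph V) [DecidableRel G.Adj]
    (P : V → Prop) [DecidablePred P] (v : V) (h : ∀ w, G.Adj v w → P w) :
    #({w | G.Adj v w} : Finset {w // P w}) = G.degree v := by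
  rw [← G.card_neighborFinset_eq_degree, ← card_map (Function.Embedding.subtype P)]
  congr 1
  ext w
  simpa using h w

/-- The color-count bound with respect to one side of a bipartition. -/
theorem logb_numColorings_le {V : Type*} [Fintype V] (G : SimpleGraph V) [DecidableRel G.Adj]
    {q d : ℕ} (hq : 2 ≤ q) (hd : 1 ≤ d) (hG : G.IsRegularOfDegree d)
    (P : V → Prop) [DecidablePred P] (hP : ∀ v w, G.Adj v w → (P v ↔ ¬ P w)) :
    Real.logb 2 (numColorings q G) ≤ Fintype.card {v // ¬ P v} *
      (Real.logb 2 ((q / 2 * ((q + 1) / 2) : ℕ) : ℝ) + q / d) := by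
  classical
  have hd0 : (d : ℝ) ≠ 0 := by positivity
  have hM : 1 ≤ q / 2 * ((q + 1) / 2) := Nat.mul_pos (by omega) (by omega)
  set M := q / 2 * ((q + 1) / 2)
  have hMR : (1 : ℝ) ≤ (M : ℝ) := by exact_mod_cast hM
  have hlogM : 0 ≤ Real.logb 2 (M : ℝ) := Real.logb_nonneg one_lt_two hMR
  rcases Nat.eq_zero_or_pos (numColorings q G) with h0 | hpos
  · rw [h0]
    simp only [Nat.cast_zero, Real.logb_zero]
    positivity
  have h1 := numColorings_le_sum_prod G q P
  have h2 := sum_prod_card_avoiding_le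
    (fun b : {v // ¬ P v} ↦ ({a | G.Adj a b} : Finset {v // P v})) hq hd
    (fun b ↦ by
      simp only [G.adj_comm _ b.1]
      rw [card_subtype_adj G P b.1 fun w hw ↦ (hP w b.1 hw.symm).2 b.2, hG.degree_eq])
    (fun a ↦ by
      simp only [mem_filter, mem_univ, true_and]
      rw [card_subtype_adj G (fun v ↦ ¬ P v) a.1 fun w hw ↦ (hP a.1 w hw).1 a.2, hG.degree_eq])
  have h3 := (Nat.cast_le (α := ℝ≥0∞).2 h1).trans h2
  have h4 := ENNReal.toReal_mono (by finiteness) h3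
  rw [ENNReal.toReal_pow, ← ENNReal.toReal_rpow, ENNReal.toReal_natCast,
    ENNReal.toReal_natCast] at h4
  have hK : (0 : ℝ) < ((2 ^ q * M ^ d : ℕ) : ℝ) := by positivity
  calc Real.logb 2 (numColorings q G)
      ≤ Real.logb 2 ((((2 ^ q * M ^ d : ℕ) : ℝ) ^ (1 / d : ℝ)) ^ Fintype.card {v // ¬ P v}) :=
        Real.logb_le_logb_of_le one_lt_two (by exact_mod_cast hpos) h4
    _ = Fintype.card {v // ¬ P v} * (Real.logb 2 (M : ℝ) + q / d) := by
        rw [Real.logb_pow, Real.logb_rpow_eq_mul_logb_of_pos hK]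
        push_cast
        rw [Real.logb_mul (by positivity) (by positivity), Real.logb_pow, Real.logb_pow,
          Real.logb_self_eq_one one_lt_two]
        field_simp
        ring

/-- Entropy upper bound on the number of proper `q`-colorings of a `d`-regular
bipartite graph on `m` vertices. -/
theorem stmt7 (q : ℕ) (hq : 2 ≤ q) :
    ∃ C : ℝ, 0 < C ∧
      ∀ (d : ℕ), 1 ≤ d →
      ∀ (V : Type) [Fintype V] (G : SimpleGraph V) [DecidableRel G.Adj],
        G.IsRegularOfDegree d → G.Colorable 2 →
        Real.logb 2 (numColorings q G) ≤
          ((Fintype.card V : ℝ) / 2) *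
            (Real.logb 2 (((q / 2) * ((q + 1) / 2) : ℕ) : ℝ) + C / d) := by
  refine ⟨q, by positivity, fun d hd V _ G _ hG ⟨col⟩ ↦ ?_⟩
  have hcol : ∀ v w, G.Adj v w → (col v = 0 ↔ ¬ col w = 0) := fun v w h ↦ by
    have := col.valid h
    omega
  have h1 := logb_numColorings_le G hq hd hG (fun v ↦ col v = 0) hcol
  have h2 := logb_numColorings_le G hq hd hG (fun v ↦ ¬ col v = 0)
    fun v w h ↦ not_congr (hcol v w h)
  have hc : (Fintype.card V : ℝ) = Fintype.card {v // ¬ col v = 0} +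
      Fintype.card {v // ¬ ¬ col v = 0} := by
    exact_mod_cast (Fintype.card_congr (Equiv.sumCompl fun v ↦ ¬ col v = 0)).symm.trans Fintype.card_sum
  rw [hc]
  linarith
end

section
/- There exists a constant C > 0 such that for every integer d ≥ 2 and every d-regular graph G on m vertices, the number i(G) of independent sets in G satisfies log₂ i(G) ≤ (1 + C·√((log₂ d)/d)) · m/2. (Sapozhenko's container bound for independent sets in regular graphs.) -/
/-- The number of independent sets in a graph `G`. -/
noncomputable def numIndep {V : Type*} (G : SimpleGraph V) : ℕ :=
  Nat.card {s : Set V // ∀ x ∈ s, ∀ y ∈ s, ¬ G.Adj x y}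

namespace IndepContainer

open Finset

variable {V : Type*} [Fintype V] [DecidableEq V] (G : SimpleGraph V) [DecidableRel G.Adj]

/-- The set of vertices with a neighbour in `T`. -/
def nbrs (T : Finset V) : Finset V := T.biUnion fun v => G.neighborFinset v

/-- The container of the fingerprint `T`: the vertices outside the neighbourhood of `T` having
fewer than `φ` neighbours outside it. -/
noncomputable def container (φ : ℝ) (T : Finset V) : Finset V :=
  univ.filter fun v => v ∉ nbrs G T ∧ ((G.neighborFinset v \ nbrs G T).card : ℝ) < φ

theorem exists_fingerprint {φ : ℝ} (hφ : 0 < φ) {I : Finset V}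
    (hI : ∀ x ∈ I, ∀ y ∈ I, ¬ G.Adj x y) :
    ∃ T : Finset V, (T.card : ℝ) * φ ≤ Fintype.card V ∧ I ⊆ container G φ T := by
  obtain ⟨T, hT, hmax⟩ := exists_max_image
    (I.powerset.filter fun T => (T.card : ℝ) * φ ≤ (nbrs G T).card) card
    ⟨∅, mem_filter.2 ⟨empty_mem_powerset I, by simp⟩⟩
  simp only [mem_filter, mem_powerset] at hT hmax
  refine ⟨T, hT.2.trans (by exact_mod_cast card_le_univ _), fun v hv => ?_⟩
  simp only [container, mem_filter, mem_univ, true_and]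
  constructor
  · simp only [nbrs, mem_biUnion, SimpleGraph.mem_neighborFinset, not_exists, not_and]
    exact fun x hx => hI x (hT.1 hx) v hv
  · by_contra! hcard
    have hvT : v ∉ T := by
      intro hvT
      have hsub : G.neighborFinset v ⊆ nbrs G T := 
        subset_biUnion_of_mem (fun v => G.neighborFinset v) hvT
      rw [sdiff_eq_empty_iff_subset.2 hsub] at hcard
      simp at hcard
      linarith
    have hunion : nbrs G (insert v T) = (G.neighborFinset v \ nbrs G T) ∪ nbrs G T := by
      simp [nbrs, biUnion_insert]
    have hle := hmax (insert v T) ⟨insert_subset hv hT.1, by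
      rw [hunion, card_union_of_disjoint sdiff_disjoint, card_insert_of_notMem hvT]
      push_cast
      linarith [hT.2]⟩
    rw [card_insert_of_notMem hvT] at hle
    omega

theorem card_container_mul_le {d : ℕ} (hG : G.IsRegularOfDegree d) (φ : ℝ) (T : Finset V) :
    ((container G φ T).card : ℝ) * (2 * d - φ) ≤ d * Fintype.card V := by
  set D := container G φ T with hD
  have hdisj : Disjoint D (nbrs G T) := by
    rw [disjoint_left]
    intro v hv
    simp only [hD, container, mem_filter] at hv
    exact hv.2.1
  have hcard : (D.card : ℝ) + (nbrs G T).card ≤ Fintype.card V := by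
    rw [← Nat.cast_add, ← card_union_of_disjoint hdisj]
    exact_mod_cast card_le_univ _
  have hcount : ∑ v ∈ D, (((nbrs G T).filter (G.Adj v)).card : ℝ) =
      ∑ w ∈ nbrs G T, ((D.filter fun v => G.Adj v w).card : ℝ) := by
    exact_mod_cast sum_card_bipartiteAbove_eq_sum_card_bipartiteBelow G.Adj
  have hlower : (D.card : ℝ) * (d - φ) ≤ ∑ v ∈ D, (((nbrs G T).filter (G.Adj v)).card : ℝ) := by
    rw [← nsmul_eq_mul]
    refine card_nsmul_le_sum _ _ _ fun v hv => ?_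
    simp only [hD, container, mem_filter] at hv
    have hsplit := card_sdiff_add_card_inter (G.neighborFinset v) (nbrs G T)
    have hinter : G.neighborFinset v ∩ nbrs G T = (nbrs G T).filter (G.Adj v) := by
      ext w
      simp [and_comm]
    rw [hinter, G.card_neighborFinset_eq_degree, hG v] at hsplit
    have hsplit' : ((G.neighborFinset v \ nbrs G T).card : ℝ) +
        ((nbrs G T).filter (G.Adj v)).card = d := by exact_mod_cast hsplit
    linarith [hv.2.2]
  have hupper : ∑ w ∈ nbrs G T, ((D.filter fun v => G.Adj v w).card : ℝ) ≤
      (nbrs G T).card * d := by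
    rw [← nsmul_eq_mul]
    refine sum_le_card_nsmul _ _ _ fun w _ => ?_
    rw [← hG w, ← G.card_neighborFinset_eq_degree]
    exact_mod_cast card_le_card fun v hv => by
      simpa using ((mem_filter.1 hv).2).symm
  have hd : (0 : ℝ) ≤ d := d.cast_nonneg
  nlinarith

theorem numIndep_le_sum {φ : ℝ} (hφ : 0 < φ) :
    numIndep G ≤ ∑ T ∈ univ.filter fun T : Finset V => (T.card : ℝ) * φ ≤ Fintype.card V,
      2 ^ (container G φ T).card := by
  classical
  set P := univ.filter fun T : Finset V => (T.card : ℝ) * φ ≤ Fintype.card V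
  have hmem (s : {s : Set V // ∀ x ∈ s, ∀ y ∈ s, ¬ G.Adj x y}) :
      s.1.toFinset ∈ P.biUnion fun T => (container G φ T).powerset := by
    obtain ⟨T, hT, hsub⟩ := exists_fingerprint G hφ (I := s.1.toFinset)
      (by simpa using s.2)
    simp only [mem_biUnion, mem_powerset]
    exact ⟨T, by simpa [P] using hT, hsub⟩
  calc numIndep G ≤ Nat.card (P.biUnion fun T => (container G φ T).powerset) :=
        Nat.card_le_card_of_injective (fun s => ⟨s.1.toFinset, hmem s⟩) fun s t hst =>
          Subtype.ext (Set.toFinset_inj.1 (congrArg Subtype.val hst))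
    _ = (P.biUnion fun T => (container G φ T).powerset).card :=
        Nat.card_eq_card_toFinset _ |>.trans (by simp only [Finset.toFinset_coe])
    _ ≤ ∑ T ∈ P, ((container G φ T).powerset).card := card_biUnion_le
    _ = _ := by simp only [card_powerset]

theorem numIndep_le {d : ℕ} (hG : G.IsRegularOfDegree d) {φ : ℝ} (hφ : 1 ≤ φ)
    (hφd : φ < 2 * d) :
    (numIndep G : ℝ) ≤ φ ^ (Fintype.card V / φ) * (1 + 1 / φ) ^ Fintype.card V *
      2 ^ (d * Fintype.card V / (2 * d - φ)) := by
  have hφ0 : 0 < φ := by linarith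
  have hterm (T : Finset V) (hT : (T.card : ℝ) * φ ≤ Fintype.card V) :
      (2 : ℝ) ^ (container G φ T).card ≤ (φ ^ (Fintype.card V / φ) *
        2 ^ (d * Fintype.card V / (2 * d - φ))) * (1 / φ) ^ T.card := by
    have hcont : (2 : ℝ) ^ (container G φ T).card ≤
        2 ^ (d * Fintype.card V / (2 * d - φ)) := by
      rw [← Real.rpow_natCast]
      refine Real.rpow_le_rpow_of_exponent_le one_le_two ?_
      rw [le_div_iff₀ (by linarith)]
      exact card_container_mul_le G hG φ T
    have hfing : 1 ≤ φ ^ (Fintype.card V / φ) * (1 / φ) ^ T.card := by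
      rw [one_div_pow, mul_one_div, one_le_div (by positivity), ← Real.rpow_natCast]
      exact Real.rpow_le_rpow_of_exponent_le hφ ((le_div_iff₀ hφ0).2 hT)
    calc (2 : ℝ) ^ (container G φ T).card
        ≤ 2 ^ (d * Fintype.card V / (2 * d - φ)) := hcont
      _ ≤ 2 ^ (d * Fintype.card V / (2 * d - φ)) *
          (φ ^ (Fintype.card V / φ) * (1 / φ) ^ T.card) :=
        le_mul_of_one_le_right (by positivity) hfing
      _ = _ := by ring
  have hbinom : ∑ T : Finset V, (1 / φ) ^ T.card = (1 + 1 / φ) ^ Fintype.card V := by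
    have h := sum_pow_mul_eq_add_pow (1 / φ) 1 (univ : Finset V)
    simpa [add_comm] using h
  calc (numIndep G : ℝ)
      ≤ ∑ T ∈ univ.filter fun T : Finset V => (T.card : ℝ) * φ ≤ Fintype.card V,
          (2 : ℝ) ^ (container G φ T).card := by exact_mod_cast numIndep_le_sum G hφ0
    _ ≤ ∑ T ∈ univ.filter fun T : Finset V => (T.card : ℝ) * φ ≤ Fintype.card V,
          (φ ^ (Fintype.card V / φ) * 2 ^ (d * Fintype.card V / (2 * d - φ))) *
            (1 / φ) ^ T.card := sum_le_sum fun T hT => hterm T (mem_filter.1 hT).2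
    _ ≤ ∑ T : Finset V, (φ ^ (Fintype.card V / φ) * 2 ^ (d * Fintype.card V / (2 * d - φ))) *
            (1 / φ) ^ T.card :=
        sum_le_sum_of_subset_of_nonneg (filter_subset _ _) fun _ _ _ => by positivity
    _ = _ := by rw [← mul_sum, hbinom]; ring

theorem logb_numIndep_le {d : ℕ} (hG : G.IsRegularOfDegree d) {φ : ℝ} (hφ : 1 ≤ φ)
    (hφd : φ < 2 * d) :
    Real.logb 2 (numIndep G) ≤ Fintype.card V / φ * (Real.logb 2 φ + 2) +
      d * Fintype.card V / (2 * d - φ) := by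
  have hφ0 : 0 < φ := by linarith
  have hpos : 0 < numIndep G :=
    Nat.card_pos_iff.2 ⟨⟨⟨∅, by simp⟩⟩, inferInstance⟩
  have hlog := Real.logb_le_logb_of_le one_lt_two (by exact_mod_cast hpos)
    (numIndep_le G hG hφ hφd)
  rw [Real.logb_mul (by positivity) (by positivity), Real.logb_mul (by positivity)
    (by positivity), Real.logb_rpow_eq_mul_logb_of_pos hφ0, Real.logb_pow,
    Real.logb_rpow two_pos (by norm_num)] at hlog
  have hone : Real.logb 2 (1 + 1 / φ) ≤ 2 / φ := by
    have hlog2 := Real.log_two_gt_d9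
    have h := Real.log_le_sub_one_of_pos (show 0 < 1 + 1 / φ by positivity)
    rw [Real.logb, div_le_iff₀ (by linarith)]
    have hinv : 0 < 1 / φ := by positivity
    have : 2 / φ = 2 * (1 / φ) := by ring
    rw [this]
    nlinarith
  have hm : (0 : ℝ) ≤ Fintype.card V := Nat.cast_nonneg _
  have hmul := mul_le_mul_of_nonneg_left hone hm
  have : (Fintype.card V : ℝ) * (2 / φ) = Fintype.card V / φ * 2 := by ring
  linarith

end IndepContainer

/-- Sapozhenko's container bound for independent sets in `d`-regular graphs. -/
theorem stmt8 :
    ∃ C : ℝ, 0 < C ∧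
      ∀ (d : ℕ), 2 ≤ d →
      ∀ (V : Type) [Fintype V] (G : SimpleGraph V) [DecidableRel G.Adj],
        G.IsRegularOfDegree d →
        Real.logb 2 (numIndep G) ≤
          (1 + C * Real.sqrt (Real.logb 2 d / d)) * ((Fintype.card V : ℝ) / 2) := by
  refine ⟨7, by norm_num, fun d hd V _ G _ hG => ?_⟩
  classical
  have hd2 : (2 : ℝ) ≤ d := by exact_mod_cast hd
  have hd0 : (0 : ℝ) < d := by linarith
  set L := Real.logb 2 d with hL
  have hL1 : 1 ≤ L := by
    rw [hL, Real.le_logb_iff_rpow_le one_lt_two hd0]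
    simpa using hd2
  have hLd : L ≤ d := by
    rw [hL, Real.logb_le_iff_le_rpow one_lt_two hd0, Real.rpow_natCast]
    exact_mod_cast Nat.lt_two_pow_self.le
  set s := Real.sqrt (L / d) with hs
  have hs0 : 0 < s := Real.sqrt_pos.2 (by positivity)
  have hs1 : s ≤ 1 := Real.sqrt_le_one.2 ((div_le_one hd0).2 hLd)
  have hsq : d * (s * s) = L := by
    rw [hs, Real.mul_self_sqrt (by positivity)]
    field_simp
  -- The threshold `φ = √(d log₂ d)`.
  have hφ : 1 ≤ d * s := by
    have : (1 : ℝ) ≤ (d * s) * (d * s) := by nlinarith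
    nlinarith [mul_pos hd0 hs0]
  have hφd : d * s ≤ d := mul_le_of_le_one_right hd0.le hs1
  have hmain := IndepContainer.logb_numIndep_le G hG hφ (by linarith)
  have hlogφ : Real.logb 2 (d * s) ≤ L :=
    Real.logb_le_logb_of_le one_lt_two (by linarith) hφd
  set m : ℝ := (Fintype.card V : ℝ) with hm
  have hm0 : 0 ≤ m := Nat.cast_nonneg _
  have hfing : m / (d * s) * (Real.logb 2 (d * s) + 2) ≤ 3 * m * s := by
    calc m / (d * s) * (Real.logb 2 (d * s) + 2) ≤ m / (d * s) * (3 * L) :=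
          mul_le_mul_of_nonneg_left (by linarith) (by positivity)
      _ = 3 * m * s := by
          rw [← hsq]
          field_simp
  have hcont : d * m / (2 * d - d * s) ≤ (1 + s) * (m / 2) := by
    rw [div_le_iff₀ (by linarith)]
    have : 0 ≤ d * m * (s * (1 - s)) := by
      have : 0 ≤ 1 - s := by linarith
      positivity
    nlinarith
  linarith
end

section
/- Let G be a d-regular graph on m vertices with d ≥ 1, and let 0 < ε < 2. Then there exists a family 𝒞 of subsets of V(G) with the following three properties: (i) for each independent set I in G there is a member C ∈ 𝒞 with I ⊆ C; (ii) every C ∈ 𝒞 satisfies |C| ≤ m/(εd) + m/(2 − ε); (iii) |𝒞| ≤ Σ_{i ≤ m/(εd)} C(m, i), where C(m,i) denotes the binomial coefficient. (Container lemma for independent sets in regular graphs.) -/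
namespace SimpleGraph

open Finset

variable {V : Type*} [Fintype V] [DecidableEq V] (G : SimpleGraph V) [DecidableRel G.Adj]

/-- The union of the neighborhoods of the vertices in `T`. -/
def neighborsOf (T : Finset V) : Finset V := T.biUnion fun v => G.neighborFinset v

/-- The vertices outside the neighborhood of `T` with fewer than `r` neighbors outside it. -/
noncomputable def container (r : ℝ) (T : Finset V) : Finset V :=
  {v | v ∉ G.neighborsOf T ∧ (#(G.neighborFinset v \ G.neighborsOf T) : ℝ) < r}

variable {G}

/-- Every independent set `I` has a fingerprint `T ⊆ I` of size at most `|V| / r` whose container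
covers `I`. -/
theorem exists_subset_container {r : ℝ} (hr : 0 < r) {I : Finset V}
    (hI : ∀ x ∈ I, ∀ y ∈ I, ¬ G.Adj x y) :
    ∃ T : Finset V, (#T : ℝ) ≤ Fintype.card V / r ∧ I ⊆ G.container r T := by
  obtain ⟨T, hT, hmax⟩ := exists_max_image
    {T ∈ I.powerset | r * #T ≤ #(G.neighborsOf T)} card
    ⟨∅, by simp⟩
  rw [mem_filter, mem_powerset] at hT
  obtain ⟨hTI, hTcard⟩ := hT
  refine ⟨T, ?_, fun v hv => ?_⟩
  · rw [le_div_iff₀ hr, mul_comm]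
    exact hTcard.trans (by exact_mod_cast card_le_univ _)
  · rw [container, mem_filter]
    refine ⟨mem_univ _, fun hmem => ?_, ?_⟩
    · obtain ⟨t, ht, htv⟩ := mem_biUnion.1 hmem
      exact hI t (hTI ht) v hv ((G.mem_neighborFinset t v).1 htv)
    · by_contra! hlarge
      have hvT : v ∉ T := fun h => by
        have hempty : G.neighborFinset v \ G.neighborsOf T = ∅ :=
          sdiff_eq_empty_iff_subset.2 (subset_biUnion_of_mem (fun v => G.neighborFinset v) h)
        rw [hempty] at hlarge
        simp only [card_empty, Nat.cast_zero] at hlarge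
        linarith
      have hins : #(G.neighborsOf (insert v T)) =
          #(G.neighborFinset v \ G.neighborsOf T) + #(G.neighborsOf T) := by
        rw [neighborsOf, biUnion_insert, ← neighborsOf, card_sdiff_add_card]
      have hle := hmax (insert v T) (by
        rw [mem_filter, mem_powerset]
        refine ⟨insert_subset hv hTI, ?_⟩
        rw [hins, card_insert_of_notMem hvT]
        push_cast
        linarith)
      rw [card_insert_of_notMem hvT] at hle
      omega

/-- In a regular graph, containers have at most `|V| / (2 - ε)` vertices. -/
theorem card_container_le {d : ℕ} (hd : 1 ≤ d) (hreg : G.IsRegularOfDegree d) {ε : ℝ}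
    (hε : ε < 2) (T : Finset V) :
    (#(G.container (ε * d) T) : ℝ) ≤ Fintype.card V / (2 - ε) := by
  set N := G.neighborsOf T
  set D := G.container (ε * d) T
  have hd' : (0 : ℝ) < d := by exact_mod_cast hd
  have hcount : ∑ v ∈ D, #(G.neighborFinset v ∩ N) = ∑ u ∈ N, #(G.neighborFinset u ∩ D) := by
    convert sum_card_bipartiteAbove_eq_sum_card_bipartiteBelow (s := D) (t := N) G.Adj using 3
    · ext; simp [and_comm]
    · ext; simp [and_comm, adj_comm]
  have hupper : ∑ u ∈ N, #(G.neighborFinset u ∩ D) ≤ #N * d :=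
    sum_le_card_nsmul _ _ _ fun u _ =>
      (card_le_card inter_subset_left).trans_eq (hreg u)
  have hlower : #D * ((1 - ε) * d) ≤ ∑ v ∈ D, (#(G.neighborFinset v ∩ N) : ℝ) := by
    rw [← nsmul_eq_mul]
    refine card_nsmul_le_sum _ _ _ fun v hv => ?_
    have hsmall : (#(G.neighborFinset v \ N) : ℝ) < ε * d := (mem_filter.1 hv).2.2
    have hsplit : (#(G.neighborFinset v \ N) : ℝ) + #(G.neighborFinset v ∩ N) = d := by
      exact_mod_cast (card_sdiff_add_card_inter _ _).trans (hreg v)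
    linarith
  have hdisj : Disjoint D N := Finset.disjoint_left.2 fun v hv => (mem_filter.1 hv).2.1
  have hsum : (#D : ℝ) + #N ≤ Fintype.card V := by
    rw [← Nat.cast_add, ← card_union_of_disjoint hdisj]
    exact_mod_cast card_le_univ _
  have hmul : (#D * (1 - ε)) * d ≤ (#N : ℝ) * d := by
    rw [mul_assoc]
    exact hlower.trans (by exact_mod_cast hcount.trans_le hupper)
  have hDN := le_of_mul_le_mul_right hmul hd'
  rw [le_div_iff₀ (by linarith)]
  linarith

end SimpleGraph

/-- The number of finsets whose size satisfies `p` is a sum of binomial coefficients. -/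
theorem Finset.card_filter_card_eq_sum_choose (V : Type*) [Fintype V] (p : ℕ → Prop)
    [DecidablePred p] :
    (Finset.univ.filter fun T : Finset V => p T.card).card =
      ∑ i ∈ range (Fintype.card V + 1) with p i, (Fintype.card V).choose i := by
  classical
  rw [card_eq_sum_card_fiberwise (f := card) (t := {i ∈ range (Fintype.card V + 1) | p i})
    fun T hT => by
      simp only [coe_filter, mem_univ, true_and, Set.mem_ofPred_eq, mem_range] at hT ⊢
      exact ⟨Nat.lt_succ_of_le (card_le_univ T), hT⟩]
  refine sum_congr rfl fun i hi => ?_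
  rw [← card_univ, ← card_powersetCard]
  congr 1
  ext T
  simp only [mem_filter, mem_univ, true_and, mem_powersetCard, subset_univ]
  exact ⟨fun h => h.2, fun h => ⟨h ▸ (mem_filter.1 hi).2, h⟩⟩

/-- Container lemma for independent sets in `d`-regular graphs. -/
theorem stmt9 (V : Type) [Fintype V] (G : SimpleGraph V) [DecidableRel G.Adj]
    (d : ℕ) (hd : 1 ≤ d) (hreg : G.IsRegularOfDegree d)
    (ε : ℝ) (hε0 : 0 < ε) (hε2 : ε < 2) :
    ∃ 𝒞 : Finset (Finset V),
      (∀ I : Finset V, (∀ x ∈ I, ∀ y ∈ I, ¬ G.Adj x y) → ∃ C ∈ 𝒞, I ⊆ C) ∧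
      (∀ C ∈ 𝒞, (C.card : ℝ) ≤
        (Fintype.card V : ℝ) / (ε * d) + (Fintype.card V : ℝ) / (2 - ε)) ∧
      ((𝒞.card : ℝ) ≤
        ∑ i ∈ (Finset.range (Fintype.card V + 1)).filter
            (fun i : ℕ => (i : ℝ) ≤ (Fintype.card V : ℝ) / (ε * d)),
          ((Fintype.card V).choose i : ℝ)) := by
  classical
  have hr : 0 < ε * d := mul_pos hε0 (by exact_mod_cast hd)
  refine ⟨Finset.image (G.container (ε * d))
    {T : Finset V | (T.card : ℝ) ≤ Fintype.card V / (ε * d)}, fun I hI => ?_, fun C hC => ?_, ?_⟩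
  · obtain ⟨T, hT, hIT⟩ := SimpleGraph.exists_subset_container hr hI
    exact ⟨_, Finset.mem_image_of_mem _ (by simpa using hT), hIT⟩
  · obtain ⟨T, -, rfl⟩ := Finset.mem_image.1 hC
    have hcard := SimpleGraph.card_container_le hd hreg hε2 T
    have hnonneg : 0 ≤ (Fintype.card V : ℝ) / (ε * d) := by positivity
    linarith
  · have hcount := Finset.card_filter_card_eq_sum_choose V
      fun i : ℕ => (i : ℝ) ≤ (Fintype.card V : ℝ) / (ε * d)
    exact_mod_cast Finset.card_image_le.trans_eq hcount
end

section
/- For all integers t, n ≥ 2, the number α([t]^n) of antichains in the poset [t]^n satisfies 2^{(2/3)·t^{n−1}/√n} ≤ α([t]^n) + 1 ≤ 2^{2·t^{n−1}}. (Moshkovitz–Shapira bounds, stated via the identity M₃(t,n) = α([t]^n) + 1.) -/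
/-- The number of antichains in the poset `[t]^n` (n-tuples of elements of
`{0,…,t−1}` with the pointwise order). -/
noncomputable def alphaT (t n : ℕ) : ℕ :=
  Nat.card {A : Finset (Fin n → Fin t) // IsAntichain (· ≤ ·) (A : Set (Fin n → Fin t))}

section Upper

variable {α β : Type*} [LinearOrder α] [LinearOrder β]

lemma card_filter_fst_lt_eq_of_isAntichain {A : Finset (α × β)}
    (hA : IsAntichain (· ≤ ·) (A : Set (α × β))) {x : α} {y : β} (h : (x, y) ∈ A) :
    ((A.image Prod.fst).filter (· < x)).card = ((A.image Prod.snd).filter (y < ·)).card := by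
  have key : ∀ p ∈ A, ∀ q ∈ A, p ≤ q → p = q := fun p hp q hq hpq => hA.eq hp hq hpq
  have h1 : (A.image Prod.fst).filter (· < x) = (A.filter (·.1 < x)).image Prod.fst := by
    ext a; simp only [Finset.mem_filter, Finset.mem_image]; grind
  have h2 : (A.image Prod.snd).filter (y < ·) = (A.filter (y < ·.2)).image Prod.snd := by
    ext a; simp only [Finset.mem_filter, Finset.mem_image]; grind
  have h3 : A.filter (·.1 < x) = A.filter (y < ·.2) := by
    refine Finset.filter_congr fun p hp => ⟨fun hlt => ?_, fun hlt => ?_⟩ <;> by_contra! hc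
    · exact hlt.ne (congrArg Prod.fst (key p hp _ h ⟨hlt.le, hc⟩))
    · exact hlt.ne (congrArg Prod.snd (key _ h p hp ⟨hc, hlt.le⟩))
  rw [h1, h2, Finset.card_image_of_injOn, Finset.card_image_of_injOn, h3]
  · intro p hp q hq hpq
    simp only [Finset.coe_filter, Set.mem_ofPred_eq] at hp hq
    rcases le_total p.1 q.1 with hle | hle
    · exact key p hp.1 q hq.1 ⟨hle, hpq.le⟩
    · exact (key q hq.1 p hp.1 ⟨hle, hpq.ge⟩).symm
  · intro p hp q hq hpq
    simp only [Finset.coe_filter, Set.mem_ofPred_eq] at hp hq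
    rcases le_total p.2 q.2 with hle | hle
    · exact key p hp.1 q hq.1 ⟨hpq.le, hle⟩
    · exact (key q hq.1 p hp.1 ⟨hpq.ge, hle⟩).symm

lemma subset_of_isAntichain_of_image_eq {A B : Finset (α × β)}
    (hA : IsAntichain (· ≤ ·) (A : Set (α × β))) (hB : IsAntichain (· ≤ ·) (B : Set (α × β)))
    (h1 : A.image Prod.fst = B.image Prod.fst) (h2 : A.image Prod.snd = B.image Prod.snd) :
    A ⊆ B := by
  rintro ⟨x, y⟩ hxy
  have hx : x ∈ B.image Prod.fst := h1 ▸ Finset.mem_image_of_mem Prod.fst hxy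
  obtain ⟨⟨x', y'⟩, hxy', rfl⟩ := Finset.mem_image.1 hx
  have hy : y ∈ B.image Prod.snd := h2 ▸ Finset.mem_image_of_mem Prod.snd hxy
  have hy' : y' ∈ B.image Prod.snd := Finset.mem_image_of_mem Prod.snd hxy'
  have hc := card_filter_fst_lt_eq_of_isAntichain hA hxy
  rw [h1, h2, card_filter_fst_lt_eq_of_isAntichain hB hxy'] at hc
  have aux : ∀ u v : β, u < v → v ∈ B.image Prod.snd →
      ((B.image Prod.snd).filter (v < ·)).card < ((B.image Prod.snd).filter (u < ·)).card := by
    intro u v huv hv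
    refine Finset.card_lt_card (Finset.ssubset_iff_of_subset ?_ |>.2 ⟨v, by simp_all, by simp⟩)
    exact Finset.monotone_filter_right _ fun w _ hw => huv.trans hw
  rcases lt_trichotomy y y' with h | h | h
  · exact absurd hc (aux _ _ h hy').ne
  · exact h ▸ hxy'
  · exact absurd hc (aux _ _ h hy).ne'

/-- An antichain in a product of two chains is determined by its two projections. -/
lemma eq_of_isAntichain_of_image_eq {A B : Finset (α × β)}
    (hA : IsAntichain (· ≤ ·) (A : Set (α × β))) (hB : IsAntichain (· ≤ ·) (B : Set (α × β)))
    (h1 : A.image Prod.fst = B.image Prod.fst) (h2 : A.image Prod.snd = B.image Prod.snd) :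
    A = B :=
  (subset_of_isAntichain_of_image_eq hA hB h1 h2).antisymm
    (subset_of_isAntichain_of_image_eq hB hA h1.symm h2.symm)

end Upper

/-- The set of pairs that extend `z` to an element of `A` on the first two coordinates. -/
def planeFiber {t m : ℕ} (A : Finset (Fin (m + 2) → Fin t)) (z : Fin m → Fin t) :
    Finset (Fin t × Fin t) :=
  {p | (Fin.cons p.1 (Fin.cons p.2 z : Fin (m + 1) → Fin t) : Fin (m + 2) → Fin t) ∈ A}

lemma isAntichain_planeFiber {t m : ℕ} {A : Finset (Fin (m + 2) → Fin t)}
    (hA : IsAntichain (· ≤ ·) (A : Set (Fin (m + 2) → Fin t))) (z : Fin m → Fin t) :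
    IsAntichain (· ≤ ·) (planeFiber A z : Set (Fin t × Fin t)) := by
  intro p hp q hq hne hle
  simp only [planeFiber, Finset.coe_filter, Finset.mem_univ, true_and, Set.mem_ofPred_eq] at hp hq
  have h := hA.eq hp hq (Fin.cons_le_cons.2 ⟨hle.1, Fin.cons_le_cons.2 ⟨hle.2, le_rfl⟩⟩)
  rw [Fin.cons_inj, Fin.cons_inj] at h
  exact hne (Prod.ext h.1 h.2.1)

lemma planeFiber_injective {t m : ℕ} :
    Function.Injective (planeFiber : Finset (Fin (m + 2) → Fin t) → _) := by
  intro A B h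
  ext x
  have hx := congrArg (fun s => (x 0, x 1) ∈ s) (congrFun h (Fin.tail (Fin.tail x)))
  have e : (Fin.cons (x 0) (Fin.cons (x 1) (Fin.tail (Fin.tail x)) : Fin (m + 1) → Fin t) :
      Fin (m + 2) → Fin t) = x := by
    have : (Fin.cons (x 1) (Fin.tail (Fin.tail x)) : Fin (m + 1) → Fin t) = Fin.tail x :=
      Fin.cons_self_tail (Fin.tail x)
    rw [this, Fin.cons_self_tail]
  simpa [planeFiber, e] using hx

lemma alphaT_add_one_le (t m : ℕ) (ht : 0 < t) :
    alphaT t (m + 2) + 1 ≤ 2 ^ (2 * t ^ (m + 1)) := by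
  have : NeZero t := ⟨ht.ne'⟩
  let T := {p : Finset (Fin t) × Finset (Fin t) // p ≠ (∅, Finset.univ)}
  let f : {A : Finset (Fin (m + 2) → Fin t) //
      IsAntichain (· ≤ ·) (A : Set (Fin (m + 2) → Fin t))} → ((Fin m → Fin t) → T) :=
    fun A z => ⟨((planeFiber A.1 z).image Prod.fst, (planeFiber A.1 z).image Prod.snd), by
      intro h
      rw [Prod.mk.injEq, Finset.image_eq_empty] at h
      have h0 := h.2
      rw [h.1, Finset.image_empty] at h0
      exact Finset.univ_nonempty.ne_empty h0.symm⟩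
  have hf : Function.Injective f := by
    intro A B h
    refine Subtype.ext (planeFiber_injective (funext fun z => ?_))
    have hz := congrArg Subtype.val (congrFun h z)
    simp only [f, Prod.mk.injEq] at hz
    exact eq_of_isAntichain_of_image_eq (isAntichain_planeFiber A.2 z)
      (isAntichain_planeFiber B.2 z) hz.1 hz.2
  have hT : Nat.card T = 4 ^ t - 1 := by
    have h4 : (4 : ℕ) ^ t = 2 ^ t * 2 ^ t := by rw [← mul_pow]; norm_num
    simp only [T, Nat.card_eq_fintype_card, ne_eq, Fintype.card_subtype_compl]
    simp [h4]
  have hle := Nat.card_le_card_of_injective f hf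
  rw [Nat.card_fun, hT] at hle
  simp only [Nat.card_eq_fintype_card (α := Fin m → Fin t), Fintype.card_fun,
    Fintype.card_fin] at hle
  calc alphaT t (m + 2) + 1 ≤ (4 ^ t - 1) ^ t ^ m + 1 := Nat.add_le_add_right hle 1
    _ ≤ (4 ^ t) ^ t ^ m :=
      Nat.pow_lt_pow_left (Nat.sub_lt (by positivity) one_pos) (by positivity)
    _ = 2 ^ (2 * t ^ (m + 1)) := by
      rw [show (4 : ℕ) = 2 ^ 2 by norm_num, ← pow_mul, ← pow_mul, pow_succ]
      ring_nf

lemma two_pow_card_le_alphaT {t n : ℕ} {A : Finset (Fin n → Fin t)}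
    (hA : IsAntichain (· ≤ ·) (A : Set (Fin n → Fin t))) : 2 ^ A.card ≤ alphaT t n := by
  let f : A.powerset → {B : Finset (Fin n → Fin t) //
      IsAntichain (· ≤ ·) (B : Set (Fin n → Fin t))} :=
    fun B => ⟨B.1, hA.subset (by exact_mod_cast Finset.mem_powerset.1 B.2)⟩
  have hf : Function.Injective f := fun B C h => 
    Subtype.ext (congrArg (fun D => D.1) h)
  have := Nat.card_le_card_of_injective f hf
  rwa [Nat.card_eq_fintype_card, Fintype.card_coe, Finset.card_powerset] at this

/-- The elements of `[t]^n` with coordinate sum `k`. -/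
def gridLayer (t n : ℕ) (k : ℤ) : Finset (Fin n → Fin t) :=
  {x | ∑ i, ((x i : ℕ) : ℤ) = k}

lemma isAntichain_gridLayer (t n : ℕ) (k : ℤ) :
    IsAntichain (· ≤ ·) (gridLayer t n k : Set (Fin n → Fin t)) := by
  intro x hx y hy hne hle
  simp only [gridLayer, Finset.coe_filter, Finset.mem_univ, true_and, Set.mem_ofPred_eq] at hx hy
  refine hne (funext fun i => Fin.ext ?_)
  have := (Finset.sum_eq_sum_iff_of_le (s := Finset.univ)
    (fun i _ => show ((x i : ℕ) : ℤ) ≤ ((y i : ℕ) : ℤ) from by exact_mod_cast hle i)).1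
    (hx.trans hy.symm) i (Finset.mem_univ i)
  exact_mod_cast this

section Moments

variable {t : ℕ} (a : Fin t → ℤ)

lemma sum_pi_sum_eq_zero (ha : ∑ j, a j = 0) (n : ℕ) :
    ∑ x : Fin n → Fin t, ∑ i, a (x i) = 0 := by
  induction n with
  | zero => simp
  | succ n ih =>
    rw [← (Fin.consEquiv fun _ => Fin t).sum_comp, Fintype.sum_prod_type]
    simp [Fin.consEquiv, Fin.sum_univ_succ, Finset.sum_add_distrib, ih, ← Finset.mul_sum, ha]

/-- The second moment of a sum of independent centered variables on `Fin t`. -/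
lemma sum_pi_sum_sq (ha : ∑ j, a j = 0) (n : ℕ) :
    t * ∑ x : Fin n → Fin t, (∑ i, a (x i)) ^ 2 = n * t ^ n * ∑ j, a j ^ 2 := by
  induction n with
  | zero => simp
  | succ n ih =>
    rw [← (Fin.consEquiv fun _ => Fin t).sum_comp, Fintype.sum_prod_type]
    simp only [Fin.consEquiv, Equiv.coe_fn_mk, Fin.sum_univ_succ, Fin.cons_zero, Fin.cons_succ,
      add_sq, Finset.sum_add_distrib, ← Finset.mul_sum, sum_pi_sum_eq_zero a ha, mul_zero,
      Finset.sum_const, Finset.card_univ, Fintype.card_fun, Fintype.card_fin, nsmul_eq_mul,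
      mul_add, ih]
    push_cast
    ring

end Moments

lemma sum_two_mul_sub (t : ℕ) : ∑ j : Fin t, (2 * ((j : ℕ) : ℤ) - (t - 1)) = 0 := by
  rw [Fin.sum_univ_eq_sum_range (fun j => 2 * (j : ℤ) - (t - 1)), Finset.sum_sub_distrib,
    ← Finset.mul_sum]
  have h : ∀ s : ℕ, 2 * ∑ j ∈ Finset.range s, (j : ℤ) = s * (s - 1) := fun s => by
    induction s with
    | zero => simp
    | succ s ih => rw [Finset.sum_range_succ, mul_add, ih]; push_cast; ring
  rw [h]
  simp
  ring

lemma three_mul_sum_two_mul_sub_sq (t : ℕ) :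
    3 * ∑ j : Fin t, (2 * ((j : ℕ) : ℤ) - (t - 1)) ^ 2 = (t : ℤ) * (t ^ 2 - 1) := by
  rw [Fin.sum_univ_eq_sum_range (fun j => (2 * (j : ℤ) - (t - 1)) ^ 2)]
  have h : ∀ (s : ℕ) (c : ℤ), 3 * ∑ j ∈ Finset.range s, (2 * (j : ℤ) - c) ^ 2 =
      s * (2 * (s - 1) * (2 * s - 1) - 6 * c * (s - 1) + 3 * c ^ 2) := fun s c => by
    induction s with
    | zero => simp
    | succ s ih => rw [Finset.sum_range_succ, mul_add, ih]; push_cast; ring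
  rw [h]; ring

lemma three_mul_sum_parabola (m : ℕ) :
    3 * ∑ i ∈ Finset.range (m + 1), ((m : ℤ) ^ 2 - (2 * i - m) ^ 2) =
      2 * (m : ℤ) * (m ^ 2 - 1) := by
  have h : ∀ (s : ℕ) (c : ℤ), 3 * ∑ i ∈ Finset.range s, (c ^ 2 - (2 * (i : ℤ) - c) ^ 2) =
      2 * s * (s - 1) * (3 * c - 2 * s + 1) := fun s c => by
    induction s with
    | zero => simp
    | succ s ih => rw [Finset.sum_range_succ, mul_add, ih]; push_cast; ring
  rw [h]; push_cast; ring

lemma three_mul_sum_centered_sq (t n : ℕ) (ht : 0 < t) :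
    3 * ∑ x : Fin n → Fin t, (2 * ∑ i, ((x i : ℕ) : ℤ) - n * (t - 1)) ^ 2 =
      (n : ℤ) * t ^ n * (t ^ 2 - 1) := by
  have h := sum_pi_sum_sq (fun j : Fin t => 2 * ((j : ℕ) : ℤ) - (t - 1)) (sum_two_mul_sub t) n
  simp only [Finset.sum_sub_distrib, ← Finset.mul_sum, Finset.sum_const, Finset.card_univ,
    Fintype.card_fin, nsmul_eq_mul] at h
  have h3 := three_mul_sum_two_mul_sub_sq t
  have ht' : (t : ℤ) ≠ 0 := by exact_mod_cast ht.ne'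
  apply mul_left_cancel₀ ht'
  rw [show (n : ℤ) * (t - 1) = n * t - n * 1 by ring]
  linear_combination 3 * h + (n * t ^ n : ℤ) * h3

/-- If every layer has at most `L` elements, weighting the layers by a parabola of half-width `m`
about the middle layer bounds the second moment of the coordinate sum from below. -/
lemma parabola_bound {t n L m : ℕ} (ht : 0 < t) (hL : ∀ k, (gridLayer t n k).card ≤ L)
    {d : ℤ} (hm : (n : ℤ) * (t - 1) = m + 2 * d) :
    (t : ℤ) ^ n * (3 * m ^ 2 - n * (t ^ 2 - 1)) ≤ L * (2 * m * (m ^ 2 - 1)) := by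
  set c : ℤ := n * (t - 1) with hc
  let S : (Fin n → Fin t) → ℤ := fun x => ∑ i, ((x i : ℕ) : ℤ)
  let g : ℤ → ℤ := fun k => (m : ℤ) ^ 2 - (2 * k - c) ^ 2
  let K : Finset ℤ := (Finset.range (m + 1)).image fun i : ℕ => d + i
  have hK : ∀ k, k ∉ K → g k ≤ 0 := by
    intro k hk
    have : k < d ∨ d + m < k := by
      by_contra! h
      refine hk (Finset.mem_image.2 ⟨(k - d).toNat, ?_, ?_⟩)
      · rw [Finset.mem_range]; omega
      · omega
    simp only [g]
    rcases this with h | h <;> nlinarith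
  have hK' : ∀ k ∈ K, 0 ≤ g k := by
    intro k hk
    obtain ⟨i, hi, rfl⟩ := Finset.mem_image.1 hk
    have hi' : (i : ℤ) ≤ m := by have := Finset.mem_range.1 hi; omega
    simp only [g, hm]
    nlinarith [Int.natCast_nonneg i]
  have h1 : ∑ x, g (S x) ≤ ∑ x with S x ∈ K, g (S x) := by
    rw [← Finset.sum_filter_add_sum_filter_not Finset.univ (fun x => S x ∈ K)]
    have : ∑ x with S x ∉ K, g (S x) ≤ 0 :=
      Finset.sum_nonpos fun x hx => hK _ (Finset.mem_filter.1 hx).2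
    linarith
  have h2 : ∑ x with S x ∈ K, g (S x) ≤ ∑ k ∈ K, L * g k := by
    rw [← Finset.sum_fiberwise_of_maps_to (t := K) (g := S)
      (fun x hx => (Finset.mem_filter.1 hx).2)]
    refine Finset.sum_le_sum fun k hk => ?_
    rw [Finset.sum_congr rfl (g := fun _ => g k)
      (fun x hx => by rw [(Finset.mem_filter.1 hx).2]), Finset.sum_const, nsmul_eq_mul]
    refine mul_le_mul_of_nonneg_right ?_ (hK' k hk)
    have hsub : (Finset.univ.filter (S · ∈ K)).filter (S · = k) ⊆ gridLayer t n k := fun x hx => by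
      simpa [gridLayer, S] using (Finset.mem_filter.1 hx).2
    exact_mod_cast (Finset.card_le_card hsub).trans (hL k)
  have h3 : 3 * ∑ k ∈ K, (L : ℤ) * g k = L * (2 * m * (m ^ 2 - 1)) := by
    rw [Finset.sum_image (fun i _ j _ h => by simpa using h), ← three_mul_sum_parabola,
      ← Finset.mul_sum, mul_left_comm]
    congr 2
    refine Finset.sum_congr rfl fun i _ => ?_
    simp only [g, hm]; ring
  have h4 : 3 * ∑ x, g (S x) = (t : ℤ) ^ n * (3 * m ^ 2 - n * (t ^ 2 - 1)) := by
    have := three_mul_sum_centered_sq t n ht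
    rw [← hc] at this
    simp only [g, S, Finset.sum_sub_distrib, Finset.sum_const, Finset.card_univ,
      Fintype.card_fun, Fintype.card_fin, nsmul_eq_mul]
    push_cast
    linear_combination -this
  linarith

lemma exists_nat_congr_near (c : ℤ) {s : ℝ} (hs : 0 ≤ s) :
    ∃ (m : ℕ) (d : ℤ), c = m + 2 * d ∧ s ≤ m ∧ (m : ℝ) ≤ s + 2 := by
  have h1 := Nat.le_ceil s
  have h2 := (Nat.ceil_lt_add_one hs).le
  rcases Int.even_or_odd (c - ⌈s⌉₊) with ⟨d, hd⟩ | ⟨d, hd⟩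
  · exact ⟨⌈s⌉₊, d, by omega, h1, by linarith⟩
  · exact ⟨⌈s⌉₊ + 1, d, by push_cast; omega, by push_cast; linarith, by push_cast; linarith⟩

lemma exists_large_gridLayer (t n : ℕ) (ht : 2 ≤ t) (hn : 2 ≤ n) :
    ∃ k, (2 / 3 : ℝ) * (t : ℝ) ^ (n - 1) / Real.sqrt n ≤ (gridLayer t n k).card := by
  have : NeZero t := ⟨by omega⟩
  let S : (Fin n → Fin t) → ℤ := fun x => ∑ i, ((x i : ℕ) : ℤ)
  obtain ⟨x₀, -, hx₀⟩ := Finset.exists_max_image Finset.univ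
    (fun x => (gridLayer t n (S x)).card) Finset.univ_nonempty
  refine ⟨S x₀, ?_⟩
  set L := (gridLayer t n (S x₀)).card
  have hL : ∀ k, (gridLayer t n k).card ≤ L := by
    intro k
    rcases (gridLayer t n k).eq_empty_or_nonempty with h | ⟨x, hx⟩
    · simp [h]
    · have : S x = k := by simpa [gridLayer] using hx
      exact this ▸ hx₀ x (Finset.mem_univ x)
  have ht' : (2 : ℝ) ≤ t := by exact_mod_cast ht
  have hn' : (2 : ℝ) ≤ n := by exact_mod_cast hn
  have hr : 1 ≤ Real.sqrt n := Real.one_le_sqrt.2 (by linarith)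
  have hr2 : Real.sqrt n ^ 2 = n := Real.sq_sqrt (by positivity)
  set s : ℝ := t * Real.sqrt n with hs
  have hs2 : s ^ 2 = n * t ^ 2 := by rw [hs, mul_pow, hr2]; ring
  have hs8 : 8 ≤ s ^ 2 := by rw [hs2]; nlinarith
  have hspos : 0 < s := by positivity
  obtain ⟨m, d, hmd, hsm, hms⟩ := exists_nat_congr_near ((n : ℤ) * (t - 1)) hspos.le
  have hb := parabola_bound (by omega) hL hmd
  have hbR : (t : ℝ) ^ n * (3 * m ^ 2 - n * (t ^ 2 - 1)) ≤ L * (2 * m * (m ^ 2 - 1)) := by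
    exact_mod_cast hb
  have hs2' : 2 ≤ s := by nlinarith
  have hP : 0 < 2 * (m : ℝ) * (m ^ 2 - 1) := by
    have : (2 : ℝ) ≤ m := hs2'.trans hsm
    have : (0 : ℝ) < m ^ 2 - 1 := by nlinarith
    positivity
  have hcubic : 2 * (2 * (m : ℝ) * (m ^ 2 - 1)) ≤ 3 * s * (3 * m ^ 2 - s ^ 2) := by
    obtain ⟨e, he⟩ : ∃ e, (m : ℝ) = s + e := ⟨m - s, by ring⟩
    have he0 : 0 ≤ e := by linarith
    have he2 : e ≤ 2 := by linarith
    rw [he]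
    nlinarith [mul_nonneg he0 (sub_nonneg.2 he2), mul_nonneg hspos.le he0,
      mul_nonneg (mul_nonneg hspos.le he0) (sub_nonneg.2 he2),
      mul_nonneg (mul_nonneg he0 he0) (sub_nonneg.2 he2),
      mul_nonneg (mul_nonneg hspos.le he0) (sub_nonneg.2 hs2'), pow_pos hspos 3]
  have hN : (0 : ℝ) < (t : ℝ) ^ n := by positivity
  have hmain : 2 * (t : ℝ) ^ n ≤ 3 * s * L := by
    refine le_of_mul_le_mul_right ?_ hP
    calc 2 * (t : ℝ) ^ n * (2 * m * (m ^ 2 - 1))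
        = (t : ℝ) ^ n * (2 * (2 * m * (m ^ 2 - 1))) := by ring
      _ ≤ (t : ℝ) ^ n * (3 * s * (3 * m ^ 2 - s ^ 2)) := by gcongr
      _ ≤ (t : ℝ) ^ n * (3 * s * (3 * m ^ 2 - n * (t ^ 2 - 1))) := by
        gcongr
        rw [hs2]; linarith
      _ = 3 * s * ((t : ℝ) ^ n * (3 * m ^ 2 - n * (t ^ 2 - 1))) := by ring
      _ ≤ 3 * s * (L * (2 * m * (m ^ 2 - 1))) := by gcongr
      _ = 3 * s * L * (2 * m * (m ^ 2 - 1)) := by ring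
  have hpow : (t : ℝ) ^ n = t * t ^ (n - 1) := by
    rw [← pow_succ', Nat.sub_add_cancel (by omega)]
  rw [div_le_iff₀ (by linarith)]
  rw [hpow, hs] at hmain
  refine le_of_mul_le_mul_left (a := 3 * (t : ℝ)) ?_ (by positivity)
  linarith

/-- The Moshkovitz–Shapira bounds, stated via `M₃(t,n) = α([t]^n) + 1`. -/
theorem stmt15 (t n : ℕ) (ht : 2 ≤ t) (hn : 2 ≤ n) :
    (2 : ℝ) ^ ((2 / 3 : ℝ) * (t : ℝ) ^ (n - 1) / Real.sqrt n) ≤ (alphaT t n : ℝ) + 1 ∧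
    (alphaT t n : ℝ) + 1 ≤ (2 : ℝ) ^ ((2 : ℝ) * (t : ℝ) ^ (n - 1)) := by
  constructor
  · obtain ⟨k, hk⟩ := exists_large_gridLayer t n ht hn
    have h := two_pow_card_le_alphaT (isAntichain_gridLayer t n k)
    calc (2 : ℝ) ^ ((2 / 3 : ℝ) * (t : ℝ) ^ (n - 1) / Real.sqrt n)
        ≤ (2 : ℝ) ^ ((gridLayer t n k).card : ℝ) :=
          Real.rpow_le_rpow_of_exponent_le one_le_two hk
      _ = ((2 ^ (gridLayer t n k).card : ℕ) : ℝ) := by rw [Real.rpow_natCast]; push_cast; rfl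
      _ ≤ alphaT t n := by exact_mod_cast h
      _ ≤ (alphaT t n : ℝ) + 1 := by linarith
  · obtain ⟨m, rfl⟩ := Nat.exists_eq_add_of_le' hn
    have h := alphaT_add_one_le t m (by omega)
    have e : (2 : ℝ) * (t : ℝ) ^ (m + 2 - 1) = ((2 * t ^ (m + 1) : ℕ) : ℝ) := by
      push_cast; rfl
    rw [e, Real.rpow_natCast]
    exact_mod_cast h
end
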